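/- arXiv:1512.05041 — 3 statements merged into one kernel-verified Lean document; each statement's English description precedes it below -/
import Mathlib

section
/- There exist constants c₁ > 0 and ε₀ > 0 such that for every ε ∈ (0, ε₀] the following holds: if (φ(t), I(t)) is a solution of the perturbed one-frequency system φ'(t) = ω(I(t)) + ε f(I(t), φ(t)), I'(t) = ε g(I(t), φ(t)), and J(t) is a solution of the averaged system J'(t) = ε G(J(t)), with I(0) = J(0) ∈ D and both I(t) and J(t) remaining in D for all 0 ≤ t ≤ 1/ε, then ‖I(t) − J(t)‖ ≤ c₁ ε for all 0 ≤ t ≤ 1/ε. -/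
open Real Set intervalIntegral

section Auxiliary

/-- A function that is periodic in a real variable and continuous over a compact set of parameters
is bounded there. -/
theorem exists_bound_of_continuousOn_of_periodic {X Y : Type*} [TopologicalSpace X]
    [SeminormedAddCommGroup Y] {K : Set X} (hK : IsCompact K) {T : ℝ} (hT : 0 < T)
    {Q : X × ℝ → Y} (hQ : ContinuousOn Q (K ×ˢ univ))
    (hper : ∀ x θ, Q (x, θ + T) = Q (x, θ)) :
    ∃ C > 0, ∀ x ∈ K, ∀ θ, ‖Q (x, θ)‖ ≤ C := by
  obtain ⟨C, hC⟩ := (hK.prod (isCompact_Icc (a := (0 : ℝ)) (b := T))).exists_bound_of_continuousOn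
    (hQ.mono (prod_mono_right (subset_univ _)))
  refine ⟨max C 1, by positivity, fun x hx θ => ?_⟩
  obtain ⟨θ', hθ', h⟩ := Function.Periodic.exists_mem_Ico₀ (f := fun θ => Q (x, θ)) (hper x) hT θ
  rw [h]
  exact (hC (x, θ') ⟨hx, Ico_subset_Icc_self hθ'⟩).trans (le_max_left _ _)

variable {E F : Type*} [NormedAddCommGroup E] [NormedSpace ℝ E]
  [NormedAddCommGroup F] [NormedSpace ℝ F]

/-- The integral over a fixed interval of a `C¹` function depending on a parameter is `C¹` in the
parameter. -/
theorem contDiff_one_parametric_intervalIntegral [LocallyCompactSpace E]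
    {k : E → ℝ → F} (hk : ContDiff ℝ 1 (fun p : E × ℝ => k p.1 p.2)) (a b : ℝ) :
    ContDiff ℝ 1 (fun x => ∫ s in a..b, k x s) := by
  set k' : E → ℝ → E →L[ℝ] F := fun x s =>
    (fderiv ℝ (fun p : E × ℝ => k p.1 p.2) (x, s)).comp (ContinuousLinearMap.inl ℝ E ℝ) with hk'
  have hk'_cont : Continuous (fun p : E × ℝ => k' p.1 p.2) :=
    (hk.continuous_fderiv one_ne_zero).clm_comp continuous_const
  have hderiv : ∀ x s, HasFDerivAt (fun x => k x s) (k' x s) x := fun x s =>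
    HasFDerivAt.comp (g := fun p : E × ℝ => k p.1 p.2) (f := fun x => (x, s)) x
      (hk.differentiable one_ne_zero (x, s)).hasFDerivAt
      (hasFDerivAt_prodMk_left x s)
  have hint : ∀ x, HasFDerivAt (fun x => ∫ s in a..b, k x s) (∫ s in a..b, k' x s) x := by
    intro x
    obtain ⟨K, hK, hxK⟩ := exists_compact_mem_nhds x
    obtain ⟨C, hC⟩ := (hK.prod (isCompact_uIcc (a := a) (b := b))).exists_bound_of_continuousOn
      hk'_cont.continuousOn
    have hcont : ∀ x, Continuous (k x) := fun x => hk.continuous.comp (.prodMk_right x)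
    refine intervalIntegral.hasFDerivAt_integral_of_dominated_of_fderiv_le (bound := fun _ => C)
      hxK (.of_forall fun y => (hcont y).aestronglyMeasurable) ((hcont x).intervalIntegrable _ _)
      (hk'_cont.comp (by fun_prop : Continuous fun s : ℝ => (x, s))).aestronglyMeasurable
      (.of_forall fun s hs y hy => hC (y, s) ⟨hy, uIoc_subset_uIcc hs⟩)
      intervalIntegrable_const (.of_forall fun s _ y _ => hderiv y s)
  refine contDiff_one_iff_fderiv.2 ⟨fun x => (hint x).differentiableAt, ?_⟩
  rw [funext fun x => (hint x).fderiv]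
  exact continuous_parametric_intervalIntegral_of_continuous' hk'_cont a b

/-- The primitive in the last variable of a `C¹` function is jointly `C¹`. -/
theorem contDiff_one_primitive [FiniteDimensional ℝ E]
    {k : E → ℝ → F} (hk : ContDiff ℝ 1 (fun p : E × ℝ => k p.1 p.2)) :
    ContDiff ℝ 1 (fun p : E × ℝ => ∫ s in (0 : ℝ)..p.2, k p.1 s) := by
  have : (fun p : E × ℝ => ∫ s in (0 : ℝ)..p.2, k p.1 s) =
      fun p => p.2 • ∫ s in (0 : ℝ)..1, k p.1 (p.2 * s) := by
    funext p
    rw [smul_integral_comp_mul_left (k p.1) p.2]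
    simp
  rw [this]
  have : ProperSpace (E × ℝ) := FiniteDimensional.proper ℝ _
  refine contDiff_snd.smul (contDiff_one_parametric_intervalIntegral
    (k := fun (p : E × ℝ) s => k p.1 (p.2 * s)) ?_ 0 1)
  exact hk.comp (f := fun q : (E × ℝ) × ℝ => (q.1.1, q.1.2 * q.2)) (by fun_prop)

/-- The oscillating part of a periodic function has a periodic primitive. -/
theorem integral_sub_average_periodic {k : ℝ → F} (hk : Continuous k) {T : ℝ} (hT : T ≠ 0)
    (hper : Function.Periodic k T) [CompleteSpace F] :
    Function.Periodic (fun θ => ∫ s in (0 : ℝ)..θ, (k s - T⁻¹ • ∫ r in (0 : ℝ)..T, k r)) T := by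
  intro θ
  set m := ∫ r in (0 : ℝ)..T, k r with hm
  have hint : ∀ a b, IntervalIntegrable (fun s => k s - T⁻¹ • m) MeasureTheory.volume a b :=
    fun a b => (hk.sub continuous_const).intervalIntegrable a b
  have hzero : ∫ s in θ..(θ + T), (k s - T⁻¹ • m) = 0 := by
    rw [integral_sub (hk.intervalIntegrable _ _) intervalIntegrable_const,
      hper.intervalIntegral_add_eq θ 0, integral_const, zero_add, ← hm, add_sub_cancel_left,
      smul_smul, mul_inv_cancel₀ hT, one_smul, sub_self]
  simp only
  rw [← integral_add_adjacent_intervals (hint 0 θ) (hint θ (θ + T)), hzero, add_zero]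

/-- A `C¹` function is Lipschitz on bounded sets. -/
theorem ContDiff.exists_pos_lipschitz_of_isBounded [FiniteDimensional ℝ E] {G : E → F}
    (hG : ContDiff ℝ 1 G) {D : Set E} (hD : Bornology.IsBounded D) :
    ∃ L > 0, ∀ x ∈ D, ∀ y ∈ D, ‖G x - G y‖ ≤ L * ‖x - y‖ := by
  have : ProperSpace E := FiniteDimensional.proper ℝ _
  obtain ⟨r, hr⟩ := hD.subset_closedBall (0 : E)
  obtain ⟨C, hC⟩ := (isCompact_closedBall (0 : E) r).exists_bound_of_continuousOn
    (hG.continuous_fderiv one_ne_zero).continuousOn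
  refine ⟨max C 1, by positivity, fun x hx y hy => ?_⟩
  exact (convex_closedBall (0 : E) r).norm_image_sub_le_of_norm_fderiv_le
    (fun z _ => hG.differentiable one_ne_zero z)
    (fun z hz => (hC z hz).trans (le_max_left _ _)) (hr hy) (hr hx)

/-- Over times `t ≤ 1 / ε`, Grönwall's inequality with initial error `C ε`, rate `L ε` and
defect `B ε²` gives an error of order `ε`. -/
theorem gronwallBound_le_mul {C L B ε t : ℝ} (hC : 0 ≤ C) (hL : 0 < L) (hB : 0 ≤ B)
    (hε : 0 < ε) (ht : t ≤ 1 / ε) :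
    gronwallBound (C * ε) (L * ε) (B * ε ^ 2) t ≤ (C + B / L) * exp L * ε := by
  rw [gronwallBound_of_K_ne_0 (by positivity)]
  have hexp : exp (L * ε * t) ≤ exp L := by
    refine exp_le_exp.2 ?_
    have : ε * t ≤ 1 := by rwa [le_div_iff₀' hε] at ht
    nlinarith
  have hB' : B * ε ^ 2 / (L * ε) = B / L * ε := by field_simp
  simp only [hB']
  calc C * ε * exp (L * ε * t) + B / L * ε * (exp (L * ε * t) - 1)
      ≤ C * ε * exp L + B / L * ε * exp L := by gcongr; linarith
    _ = (C + B / L) * exp L * ε := by ring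

/-- Comparison of a trajectory `I` of `I' = ε (G(I) + k)`, where the oscillating part `k` is
`h' - ε R` with `h` and `R` bounded, with a trajectory `J` of `J' = ε G(J)`. -/
theorem norm_sub_le_of_oscillating_perturbation {D : Set E} {G : E → E} {C L M ε : ℝ}
    (hC : 0 ≤ C) (hL : 0 < L) (hM : 0 ≤ M) (hε : 0 < ε)
    (hG : ∀ x ∈ D, ∀ y ∈ D, ‖G x - G y‖ ≤ L * ‖x - y‖) {I J h k R : ℝ → E}
    (hI : ∀ t ∈ Icc (0 : ℝ) (1 / ε), HasDerivAt I (ε • (G (I t) + k t)) t)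
    (hJ : ∀ t ∈ Icc (0 : ℝ) (1 / ε), HasDerivAt J (ε • G (J t)) t)
    (hh : ∀ t ∈ Icc (0 : ℝ) (1 / ε), HasDerivAt h (k t + ε • R t) t)
    (hhC : ∀ t ∈ Icc (0 : ℝ) (1 / ε), ‖h t‖ ≤ C) (hRM : ∀ t ∈ Icc (0 : ℝ) (1 / ε), ‖R t‖ ≤ M)
    (h0 : I 0 = J 0) (hID : ∀ t ∈ Icc (0 : ℝ) (1 / ε), I t ∈ D)
    (hJD : ∀ t ∈ Icc (0 : ℝ) (1 / ε), J t ∈ D) :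
    ∀ t ∈ Icc (0 : ℝ) (1 / ε), ‖I t - J t‖ ≤ ((C + (L * C + M) / L) * exp L + C) * ε := by
  intro t ht
  have hd : ∀ t ∈ Icc (0 : ℝ) (1 / ε), HasDerivAt (fun t => I t - J t - ε • h t)
      (ε • (G (I t) - G (J t)) - ε ^ 2 • R t) t := fun t ht =>
    (((hI t ht).sub (hJ t ht)).sub ((hh t ht).const_smul ε)).congr_deriv (by module)
  have hεh : ∀ t ∈ Icc (0 : ℝ) (1 / ε), ‖ε • h t‖ ≤ C * ε := fun t ht => by
    rw [norm_smul, norm_of_nonneg hε.le, mul_comm]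
    exact mul_le_mul_of_nonneg_right (hhC t ht) hε.le
  have hsub : ∀ t ∈ Icc (0 : ℝ) (1 / ε), ‖I t - J t‖ ≤ ‖I t - J t - ε • h t‖ + C * ε :=
    fun t ht => by
      calc ‖I t - J t‖ = ‖(I t - J t - ε • h t) + ε • h t‖ := by rw [sub_add_cancel]
        _ ≤ _ := (norm_add_le _ _).trans (by gcongr; exact hεh t ht)
  have hgron := norm_le_gronwallBound_of_norm_deriv_right_le (δ := C * ε) (K := L * ε)
    (ε := (L * C + M) * ε ^ 2) (fun t ht => (hd t ht).continuousAt.continuousWithinAt)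
    (fun t ht => (hd t (Ico_subset_Icc_self ht)).hasDerivWithinAt)
    (by simpa [h0] using hεh 0 (left_mem_Icc.2 (by positivity)))
    (fun t ht => by
      have ht := Ico_subset_Icc_self ht
      calc ‖ε • (G (I t) - G (J t)) - ε ^ 2 • R t‖
          ≤ ε * ‖G (I t) - G (J t)‖ + ε ^ 2 * ‖R t‖ := by
            refine (norm_sub_le _ _).trans_eq ?_
            rw [norm_smul, norm_smul, norm_of_nonneg hε.le, norm_of_nonneg (sq_nonneg ε)]
        _ ≤ ε * (L * (‖I t - J t - ε • h t‖ + C * ε)) + ε ^ 2 * M := by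
            gcongr
            · exact (hG _ (hID t ht) _ (hJD t ht)).trans (by gcongr; exact hsub t ht)
            · exact hRM t ht
        _ = L * ε * ‖I t - J t - ε • h t‖ + (L * C + M) * ε ^ 2 := by ring) t ht
  rw [sub_zero] at hgron
  linarith [hsub t ht, hgron.trans (gronwallBound_le_mul hC hL (by positivity) hε ht.2)]

end Auxiliary

/-- **Classical periodic averaging theorem for one-frequency systems.**
Let `D ⊆ ℝⁿ` be open and bounded, `f`, `g` smooth and `2π`-periodic in the angle variable,
and let the frequency `ω` be smooth with `ω ≥ 1/c > 0` on the closure of `D`. Then there are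
constants `c₁ > 0`, `ε₀ > 0` such that for `0 < ε ≤ ε₀`, any solution `(φ, I)` of the perturbed
system `φ' = ω(I) + ε f(I, φ)`, `I' = ε g(I, φ)` and any solution `J` of the averaged system
`J' = ε G(J)`, `G(J) = (1/2π) ∫₀^{2π} g(J, θ) dθ`, with `I 0 = J 0 ∈ D` and `I, J` staying in
`D` on `[0, 1/ε]`, satisfy `‖I t - J t‖ ≤ c₁ ε` on `[0, 1/ε]`. -/
theorem classical_periodic_averaging
    (n : ℕ) (D : Set (EuclideanSpace ℝ (Fin n))) (hD : IsOpen D) (hDb : Bornology.IsBounded D)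
    (f : EuclideanSpace ℝ (Fin n) → ℝ → ℝ)
    (g : EuclideanSpace ℝ (Fin n) → ℝ → EuclideanSpace ℝ (Fin n))
    (ω : EuclideanSpace ℝ (Fin n) → ℝ)
    (hf : ContDiff ℝ (⊤ : ℕ∞) (fun p : EuclideanSpace ℝ (Fin n) × ℝ => f p.1 p.2))
    (hg : ContDiff ℝ (⊤ : ℕ∞) (fun p : EuclideanSpace ℝ (Fin n) × ℝ => g p.1 p.2))
    (hω : ContDiff ℝ (⊤ : ℕ∞) ω)
    (hfper : ∀ x θ, f x (θ + 2 * π) = f x θ)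
    (hgper : ∀ x θ, g x (θ + 2 * π) = g x θ)
    (c : ℝ) (hc : 0 < c) (hωpos : ∀ x ∈ closure D, 1 / c ≤ ω x)
    (G : EuclideanSpace ℝ (Fin n) → EuclideanSpace ℝ (Fin n))
    (hG : ∀ J, G J = (2 * π)⁻¹ • ∫ θ in (0:ℝ)..(2 * π), g J θ) :
    ∃ c₁ > 0, ∃ ε₀ > 0, ∀ ε ∈ Ioc (0:ℝ) ε₀,
      ∀ (φ : ℝ → ℝ) (I J : ℝ → EuclideanSpace ℝ (Fin n)),
        (∀ t ∈ Icc (0:ℝ) (1 / ε), HasDerivAt φ (ω (I t) + ε * f (I t) (φ t)) t) →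
        (∀ t ∈ Icc (0:ℝ) (1 / ε), HasDerivAt I (ε • g (I t) (φ t)) t) →
        (∀ t ∈ Icc (0:ℝ) (1 / ε), HasDerivAt J (ε • G (J t)) t) →
        I 0 = J 0 → I 0 ∈ D →
        (∀ t ∈ Icc (0:ℝ) (1 / ε), I t ∈ D) →
        (∀ t ∈ Icc (0:ℝ) (1 / ε), J t ∈ D) →
        ∀ t ∈ Icc (0:ℝ) (1 / ε), ‖I t - J t‖ ≤ c₁ * ε := by
  have hg1 : ContDiff ℝ 1 (fun p : EuclideanSpace ℝ (Fin n) × ℝ => g p.1 p.2) :=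
    hg.of_le (by exact_mod_cast le_top)
  have hω1 : ContDiff ℝ 1 ω := hω.of_le (by exact_mod_cast le_top)
  have hG1 : ContDiff ℝ 1 G := by
    rw [funext hG]
    exact contDiff_const (c := (2 * π)⁻¹) |>.smul (contDiff_one_parametric_intervalIntegral hg1 _ _)
  set k : EuclideanSpace ℝ (Fin n) → ℝ → EuclideanSpace ℝ (Fin n) := fun x θ => g x θ - G x
    with hk
  have hk1 : ContDiff ℝ 1 (fun p : EuclideanSpace ℝ (Fin n) × ℝ => k p.1 p.2) :=
    hg1.sub (hG1.comp contDiff_fst)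
  set u : EuclideanSpace ℝ (Fin n) × ℝ → EuclideanSpace ℝ (Fin n) :=
    fun p => ∫ s in (0 : ℝ)..p.2, k p.1 s with hu
  have hu1 : ContDiff ℝ 1 u := contDiff_one_primitive hk1
  have hk_cont : ∀ x, Continuous (k x) := fun x => hk1.continuous.comp (.prodMk_right x)
  have hg_cont : ∀ x, Continuous (g x) := fun x => hg1.continuous.comp (.prodMk_right x)
  have huper : ∀ x θ, u (x, θ + 2 * π) = u (x, θ) := fun x θ => by
    simpa only [hu, hk, hG] using
      integral_sub_average_periodic (hg_cont x) two_pi_pos.ne' (hgper x) θ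
  have hu'per : ∀ x θ, fderiv ℝ u (x, θ + 2 * π) = fderiv ℝ u (x, θ) := fun x θ => by
    have h := fderiv_comp_add_right (𝕜 := ℝ) (f := u) (x := (x, θ)) (0, 2 * π)
    rw [Prod.mk_add_mk, add_zero] at h
    rw [← h]
    congr 1
    funext ⟨y, ψ⟩
    rw [Prod.mk_add_mk, add_zero, huper]
  have hu'k : ∀ x θ, fderiv ℝ u (x, θ) (0, 1) = k x θ := fun x θ => by
    have h := (hu1.differentiable one_ne_zero (x, θ)).hasFDerivAt.comp_hasDerivAt θ
      ((hasDerivAt_const θ x).prodMk (hasDerivAt_id θ))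
    exact h.unique ((hk_cont x).integral_hasStrictDerivAt 0 θ).hasDerivAt
  have hωpos' : ∀ x ∈ closure D, 0 < ω x := fun x hx => (by positivity : 0 < 1 / c).trans_le
    (hωpos x hx)
  have hK : IsCompact (closure D) := hDb.isCompact_closure
  have hωinv : ContinuousOn (fun p : EuclideanSpace ℝ (Fin n) × ℝ => (ω p.1)⁻¹)
      (closure D ×ˢ univ) :=
    (hω1.continuous.comp continuous_fst).continuousOn.inv₀ fun p hp => (hωpos' p.1 hp.1).ne'
  set h : EuclideanSpace ℝ (Fin n) × ℝ → EuclideanSpace ℝ (Fin n) :=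
    fun p => (ω p.1)⁻¹ • u p with hh
  set R : EuclideanSpace ℝ (Fin n) × ℝ → EuclideanSpace ℝ (Fin n) := fun p =>
    (ω p.1)⁻¹ • fderiv ℝ u p (g p.1 p.2, f p.1 p.2)
      - ((ω p.1)⁻¹ ^ 2 * fderiv ℝ ω p.1 (g p.1 p.2)) • u p with hR
  obtain ⟨C, hC, hhC⟩ : ∃ C > 0, ∀ x ∈ closure D, ∀ θ, ‖h (x, θ)‖ ≤ C :=
    exists_bound_of_continuousOn_of_periodic hK two_pi_pos (hωinv.smul hu1.continuous.continuousOn)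
      (fun x θ => by simp only [hh, huper])
  obtain ⟨M, hM, hRM⟩ : ∃ M > 0, ∀ x ∈ closure D, ∀ θ, ‖R (x, θ)‖ ≤ M := by
    refine exists_bound_of_continuousOn_of_periodic hK two_pi_pos ?_
      (fun x θ => by simp only [hR, huper, hu'per, hgper, hfper])
    have h1 : Continuous fun p : EuclideanSpace ℝ (Fin n) × ℝ =>
        fderiv ℝ u p (g p.1 p.2, f p.1 p.2) :=
      (hu1.continuous_fderiv one_ne_zero).clm_apply (hg1.continuous.prodMk hf.continuous)
    have h2 : Continuous fun p : EuclideanSpace ℝ (Fin n) × ℝ => fderiv ℝ ω p.1 (g p.1 p.2) :=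
      ((hω1.continuous_fderiv one_ne_zero).comp continuous_fst).clm_apply hg1.continuous
    exact (hωinv.smul h1.continuousOn).sub
      (((hωinv.pow 2).mul h2.continuousOn).smul hu1.continuous.continuousOn)
  obtain ⟨L, hL, hGL⟩ := hG1.exists_pos_lipschitz_of_isBounded hDb
  refine ⟨(C + (L * C + M) / L) * exp L + C, by positivity, 1, one_pos, ?_⟩
  intro ε hε φ I J hφ hI hJ h0 _ hID hJD
  refine norm_sub_le_of_oscillating_perturbation (h := fun t => h (I t, φ t))
    (k := fun t => k (I t) (φ t)) (R := fun t => R (I t, φ t)) hC.le hL hM.le hε.1 hGL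
    (fun t ht => by simpa [hk] using hI t ht) hJ (fun t ht => ?_)
    (fun t ht => hhC _ (subset_closure (hID t ht)) _)
    (fun t ht => hRM _ (subset_closure (hID t ht)) _) h0 hID hJD
  have hω0 := (hωpos' _ (subset_closure (hID t ht))).ne'
  have hωI := ((hω1.differentiable one_ne_zero (I t)).hasFDerivAt.comp_hasDerivAt t
    (hI t ht)).inv hω0
  have huI := (hu1.differentiable one_ne_zero (I t, φ t)).hasFDerivAt.comp_hasDerivAt t
    ((hI t ht).prodMk (hφ t ht))
  have hsplit : (ε • g (I t) (φ t), ω (I t) + ε * f (I t) (φ t)) =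
      ω (I t) • ((0, 1) : EuclideanSpace ℝ (Fin n) × ℝ)
        + ε • (g (I t) (φ t), f (I t) (φ t)) := by
    simp
  refine (hωI.smul huI).congr_deriv ?_
  rw [hsplit, map_add, map_smul, map_smul, map_smul, hu'k]
  simp only [hR, Function.comp, Pi.inv_apply, smul_add, smul_sub, smul_smul, inv_mul_cancel₀ hω0,
    one_smul, smul_eq_mul]
  module
end

section
/- Let N ⊂ ℝⁿ be an open set with compact closure. Then there exist δ > 0 and C > 0 such that the flow Ψ of Z is defined on (−δ, δ) × N, each Ψ_ε := Ψ(ε,·) is a diffeomorphism of N onto its image with invertible differential D_mΨ_ε at every m ∈ N, and for all ε ∈ [0, δ] and all m ∈ N the pullback of the perturbed vector field X_ε = X₀ + εX₁ satisfies ‖(D_mΨ_ε)⁻¹((X₀ + εX₁)(Ψ_ε(m))) − X₀(m) − ε⟨X₁⟩(m)‖ ≤ C ε²; that is, Ψ_ε brings X_ε into the S¹-invariant normal form X₀ + ε⟨X₁⟩ + O(ε²) uniformly on N. -/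
open Real Set intervalIntegral

section

variable (E : Type*) [NormedAddCommGroup E] [NormedSpace ℝ E]

/-- The averaging operator on vector fields associated with a `2π`-periodic flow `φ`:
`⟨Y⟩(p) = (1/2π) ∫₀^{2π} ((φ_t)^* Y)(p) dt`, where `((φ_t)^* Y)(p) = (D_p φ_t)⁻¹(Y(φ_t(p)))`
is the pullback of `Y` along the diffeomorphism `φ_t` (Mathlib's `VectorField.pullback`). -/
noncomputable def flowAverageVF (φ : ℝ → E → E) (Y : E → E) (p : E) : E :=
  (2 * π)⁻¹ • ∫ t in (0:ℝ)..(2 * π), VectorField.pullback ℝ (φ t) Y p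

/-- The integrating operator on vector fields:
`S(Y)(p) = (1/2π) ∫₀^{2π} (t - π) ((φ_t)^* Y)(p) dt`. -/
noncomputable def flowIntegratingVF (φ : ℝ → E → E) (Y : E → E) (p : E) : E :=
  (2 * π)⁻¹ • ∫ t in (0:ℝ)..(2 * π), (t - π) • VectorField.pullback ℝ (φ t) Y p

/-- The integrating operator on functions:
`S(h)(p) = (1/2π) ∫₀^{2π} (t - π) h(φ(t,p)) dt`. -/
noncomputable def flowIntegratingFn (φ : ℝ → E → E) (h : E → ℝ) (p : E) : ℝ :=
  (2 * π)⁻¹ * ∫ t in (0:ℝ)..(2 * π), (t - π) * h (φ t p)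

end

universe u

section Superposition

variable {K E F G : Type*} [TopologicalSpace K] [CompactSpace K]
  [NormedAddCommGroup E] [NormedSpace ℝ E] [NormedAddCommGroup F] [NormedSpace ℝ F]
  [NormedAddCommGroup G] [NormedSpace ℝ G]

/-- Pointwise application of a continuous family of operators to a continuous family of vectors,
as a continuous bilinear map. -/
noncomputable def pointwiseApplyL :
    C(K, E →L[ℝ] F) →L[ℝ] C(K, E) →L[ℝ] C(K, F) :=
  LinearMap.mkContinuous₂
    (LinearMap.mk₂ ℝ
      (fun (A : C(K, E →L[ℝ] F)) (v : C(K, E)) => (⟨fun s => A s (v s), by fun_prop⟩ : C(K, F)))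
      (fun A B v => by ext; simp) (fun c A v => by ext; simp)
      (fun A v w => by ext; simp) (fun c A v => by ext; simp)) 1
    (fun A v => by
      rw [one_mul, ContinuousMap.norm_le _ (by positivity)]
      intro s
      exact ((A s).le_opNorm (v s)).trans (mul_le_mul (A.norm_coe_le_norm s)
        (v.norm_coe_le_norm s) (norm_nonneg _) (norm_nonneg A)))

@[simp]
theorem pointwiseApplyL_apply (A : C(K, E →L[ℝ] F)) (v : C(K, E)) (s : K) :
    pointwiseApplyL A v s = A s (v s) := rfl

/-- The embedding of a normed space as the constant functions. -/
noncomputable def constMapL : E →L[ℝ] C(K, E) :=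
  LinearMap.mkContinuous
    { toFun := fun p => ContinuousMap.const _ p
      map_add' := fun p q => by ext; simp
      map_smul' := fun c p => by ext; simp } 1
    (fun p => by
      rw [one_mul, ContinuousMap.norm_le _ (norm_nonneg _)]
      intro s
      simp)

@[simp]
theorem constMapL_apply (p : E) (s : K) : constMapL p s = p := rfl

/-- A superposition operator induced by a `C¹` function is differentiable. -/
theorem hasFDerivAt_superposition {f : E → F} {f' : E → E →L[ℝ] F}
    (hf : ∀ x, HasFDerivAt f (f' x) x) (hfc : Continuous f) (hf'c : Continuous f')
    (u : C(K, E)) :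
    HasFDerivAt (fun u : C(K, E) => (⟨f, hfc⟩ : C(E, F)).comp u)
      (pointwiseApplyL ((⟨f', hf'c⟩ : C(E, E →L[ℝ] F)).comp u)) u := by
  refine .of_isLittleO ?_
  rw [Asymptotics.isLittleO_iff]
  intro c hc
  have hcont : Continuous fun v : C(K, E) => (⟨f', hf'c⟩ : C(E, E →L[ℝ] F)).comp v :=
    ContinuousMap.continuous_postcomp _
  obtain ⟨δ, hδ, hball⟩ := Metric.eventually_nhds_iff_ball.1
    (hcont.continuousAt.eventually_mem
      (Metric.ball_mem_nhds ((⟨f', hf'c⟩ : C(E, E →L[ℝ] F)).comp u) hc))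
  filter_upwards [Metric.ball_mem_nhds u hδ] with v hv
  rw [ContinuousMap.norm_le _ (by positivity)]
  intro s
  have key : ∀ y ∈ segment ℝ (u s) (v s), ‖f' y - f' (u s)‖ ≤ c := by
    intro y hy
    rw [segment_eq_image'] at hy
    obtain ⟨θ, hθ, rfl⟩ := hy
    have hw : u + θ • (v - u) ∈ Metric.ball u δ := by
      rw [mem_ball_iff_norm] at hv ⊢
      rw [add_sub_cancel_left, norm_smul, Real.norm_of_nonneg hθ.1]
      exact (mul_le_of_le_one_left (norm_nonneg _) hθ.2).trans_lt hv
    have h1 := hball _ hw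
    rw [← dist_eq_norm]
    exact (ContinuousMap.dist_apply_le_dist s).trans (Metric.mem_ball.1 h1).le
  have := (convex_segment (u s) (v s)).norm_image_sub_le_of_norm_hasFDerivWithin_le'
    (fun y _ => (hf y).hasFDerivWithinAt) key (left_mem_segment ℝ _ _) (right_mem_segment ℝ _ _)
  exact this.trans (mul_le_mul_of_nonneg_left ((v - u).norm_coe_le_norm s) hc.le)

end Superposition

theorem contDiff_superposition_nat {K : Type*} [TopologicalSpace K] [CompactSpace K]
    {E : Type u} [NormedAddCommGroup E] [NormedSpace ℝ E] (n : ℕ) :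
    ∀ {F : Type u} [NormedAddCommGroup F] [NormedSpace ℝ F] {f : E → F} (hfc : Continuous f),
      ContDiff ℝ n f → ContDiff ℝ n (fun u : C(K, E) => (⟨f, hfc⟩ : C(E, F)).comp u) := by
  induction n with
  | zero =>
    intro F _ _ f hfc hf
    rw [Nat.cast_zero, contDiff_zero]
    exact ContinuousMap.continuous_postcomp _
  | succ n ih =>
    intro F _ _ f hfc hf
    rw [Nat.cast_succ, contDiff_succ_iff_hasFDerivAt] at hf ⊢
    obtain ⟨f', hf'c, hf'⟩ := hf
    exact ⟨_, pointwiseApplyL.contDiff.comp (ih hf'c.continuous hf'c),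
      hasFDerivAt_superposition hf' hfc hf'c.continuous⟩

/-- The superposition operator induced by a smooth function is smooth. -/
theorem contDiff_superposition {K : Type*} [TopologicalSpace K] [CompactSpace K]
    {E F : Type u} [NormedAddCommGroup E] [NormedSpace ℝ E]
    [NormedAddCommGroup F] [NormedSpace ℝ F] {f : E → F} (hf : ContDiff ℝ (⊤ : ℕ∞) f) :
    ContDiff ℝ (⊤ : ℕ∞) (fun u : C(K, E) => (⟨f, hf.continuous⟩ : C(E, F)).comp u) :=
  contDiff_infty.2 fun n => contDiff_superposition_nat n hf.continuous (contDiff_infty.1 hf n)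

section Primitive

variable {F : Type*} [NormedAddCommGroup F] [NormedSpace ℝ F]

theorem norm_primitive_le (v : C(Icc (-1 : ℝ) 1, F)) (s : Icc (-1 : ℝ) 1) :
    ‖∫ τ in (0 : ℝ)..s, v (projIcc (-1) 1 (by norm_num) τ)‖ ≤ ‖v‖ := by
  have h := intervalIntegral.norm_integral_le_of_norm_le_const (a := 0) (b := (s : ℝ))
    (f := fun τ => v (projIcc (-1) 1 (by norm_num) τ)) (C := ‖v‖)
    (fun τ _ => v.norm_coe_le_norm _)
  refine h.trans (mul_le_of_le_one_right (norm_nonneg _) ?_)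
  rw [sub_zero, abs_le]
  exact s.2

/-- The primitive vanishing at `0` of a continuous function on `[-1, 1]`, as a bounded operator. -/
noncomputable def primitiveL : C(Icc (-1 : ℝ) 1, F) →L[ℝ] C(Icc (-1 : ℝ) 1, F) :=
  LinearMap.mkContinuous
    { toFun := fun v => ⟨fun s => ∫ τ in (0 : ℝ)..s, v (projIcc (-1) 1 (by norm_num) τ), by
        have : Continuous fun s : ℝ => ∫ τ in (0 : ℝ)..s, v (projIcc (-1) 1 (by norm_num) τ) :=
          intervalIntegral.continuous_primitive
            (fun _ _ => (v.continuous.comp continuous_projIcc).intervalIntegrable _ _) 0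
        exact this.comp continuous_subtype_val⟩
      map_add' := fun v w => by
        ext s
        exact intervalIntegral.integral_add
          ((v.continuous.comp continuous_projIcc).intervalIntegrable _ _)
          ((w.continuous.comp continuous_projIcc).intervalIntegrable _ _)
      map_smul' := fun c v => by
        ext s
        exact intervalIntegral.integral_smul c _ } 1
    (fun v => by
      rw [one_mul, ContinuousMap.norm_le _ (norm_nonneg _)]
      exact norm_primitive_le v)

theorem primitiveL_apply (v : C(Icc (-1 : ℝ) 1, F)) (s : Icc (-1 : ℝ) 1) :
    primitiveL v s = ∫ τ in (0 : ℝ)..s, v (projIcc (-1) 1 (by norm_num) τ) := rfl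

theorem norm_primitiveL_le (v : C(Icc (-1 : ℝ) 1, F)) : ‖primitiveL v‖ ≤ ‖v‖ :=
  (ContinuousMap.norm_le _ (norm_nonneg _)).2 (norm_primitive_le v)

end Primitive

/-- Smooth dependence of an integral on a parameter. -/
theorem contDiff_parametric_intervalIntegral {E F : Type u} [NormedAddCommGroup E]
    [NormedSpace ℝ E] [NormedAddCommGroup F] [NormedSpace ℝ F] {f : ℝ × E → F}
    (hf : ContDiff ℝ (⊤ : ℕ∞) f) (b : ℝ) :
    ContDiff ℝ (⊤ : ℕ∞) (fun p => ∫ t in (0 : ℝ)..b, f (t, p)) := by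
  let T : C(Icc (-1 : ℝ) 1, ℝ × E) := ⟨fun s => (b * (s : ℝ), 0), by fun_prop⟩
  let L : E →L[ℝ] C(Icc (-1 : ℝ) 1, ℝ × E) := constMapL ∘L .inr ℝ ℝ E
  have hι : ContDiff ℝ (⊤ : ℕ∞) fun p => T + L p := contDiff_const.add L.contDiff
  have h1 : ContDiff ℝ (⊤ : ℕ∞) fun p =>
      b • primitiveL ((⟨f, hf.continuous⟩ : C(ℝ × E, F)).comp (T + L p)) :=
    (primitiveL.contDiff.comp ((contDiff_superposition hf).comp hι)).const_smul b
  have h2 := (ContinuousMap.evalCLM ℝ (⟨1, by norm_num⟩ : Icc (-1 : ℝ) 1)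
    (M := F)).contDiff.comp h1
  convert h2 using 2 with p
  have h3 := intervalIntegral.smul_integral_comp_mul_left (a := 0) (b := 1)
    (fun t => f (t, p)) b
  rw [mul_zero, mul_one] at h3
  rw [← h3]
  simp only [Function.comp_apply, ContinuousMap.evalCLM_apply, ContinuousMap.smul_apply,
    primitiveL_apply]
  congr 1
  refine intervalIntegral.integral_congr fun t ht => ?_
  rw [uIcc_of_le zero_le_one] at ht
  have : projIcc (-1 : ℝ) 1 (by norm_num) t = ⟨t, by linarith [ht.1], ht.2⟩ :=
    projIcc_of_mem _ ⟨by linarith [ht.1], ht.2⟩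
  simp [this, T, L]

/-- The derivative of a strict Lipschitz perturbation of the identity is invertible. -/
theorem isInvertible_fderiv_of_lipschitzWith_sub_id {E : Type*} [NormedAddCommGroup E]
    [NormedSpace ℝ E] [CompleteSpace E] {g : E → E} {x : E} {k : NNReal} (hk : k < 1)
    (hg : DifferentiableAt ℝ g x) (hl : LipschitzWith k fun y => g y - y) :
    (fderiv ℝ g x).IsInvertible := by
  have h1 := norm_fderiv_le_of_lipschitz ℝ hl (x₀ := x)
  have h2 : fderiv ℝ (fun y => g y - y) x = fderiv ℝ g x - ContinuousLinearMap.id ℝ E := by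
    rw [fderiv_fun_sub hg differentiableAt_fun_id, fderiv_fun_id]
  rw [h2] at h1
  have h3 : ‖(1 : E →L[ℝ] E) - fderiv ℝ g x‖ < 1 := by
    rw [norm_sub_rev]
    exact h1.trans_lt (by exact_mod_cast hk)
  have h4 := isUnit_one_sub_of_norm_lt_one h3
  rw [sub_sub_cancel] at h4
  obtain ⟨U, hU⟩ := h4
  exact ⟨ContinuousLinearEquiv.ofUnit U, by rw [← hU]; rfl⟩

section LocalFlow

variable {E : Type u} [NormedAddCommGroup E] [NormedSpace ℝ E]

/-- The Picard operator for `u' = ε f(u)`, `u(0) = x`, on `[-1, 1]`. -/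
noncomputable def scaledPicard (f : C(E, E)) (ε : ℝ) (x : E) (u : C(Icc (-1 : ℝ) 1, E)) :
    C(Icc (-1 : ℝ) 1, E) :=
  constMapL x + ε • primitiveL (f.comp u)

theorem scaledPicard_apply (f : C(E, E)) (ε : ℝ) (x : E) (u : C(Icc (-1 : ℝ) 1, E))
    (s : Icc (-1 : ℝ) 1) :
    scaledPicard f ε x u s =
      x + ε • ∫ τ in (0 : ℝ)..s, f (u (projIcc (-1) 1 (by norm_num) τ)) := rfl

theorem norm_primitiveL_comp_sub_le {f : C(E, E)} {L : NNReal} (hL : LipschitzWith L f)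
    (u v : C(Icc (-1 : ℝ) 1, E)) :
    ‖primitiveL (f.comp u) - primitiveL (f.comp v)‖ ≤ L * ‖u - v‖ := by
  rw [← map_sub]
  refine (norm_primitiveL_le _).trans ?_
  rw [ContinuousMap.norm_le _ (by positivity)]
  intro s
  exact (hL.norm_sub_le _ _).trans
    (mul_le_mul_of_nonneg_left ((u - v).norm_coe_le_norm s) L.2)

theorem norm_scaledPicard_sub_le {f : C(E, E)} {L : NNReal} (hL : LipschitzWith L f) {ε : ℝ}
    (hε : |ε| * L ≤ 1 / 4) (x y : E) (u v : C(Icc (-1 : ℝ) 1, E)) :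
    ‖(scaledPicard f ε x u - constMapL x) - (scaledPicard f ε y v - constMapL y)‖
      ≤ 1 / 4 * ‖u - v‖ := by
  have h : (scaledPicard f ε x u - constMapL x) - (scaledPicard f ε y v - constMapL y) =
      ε • (primitiveL (f.comp u) - primitiveL (f.comp v)) := by
    simp only [scaledPicard, smul_sub]
    abel
  rw [h, norm_smul, Real.norm_eq_abs]
  calc |ε| * ‖primitiveL (f.comp u) - primitiveL (f.comp v)‖
      ≤ |ε| * (L * ‖u - v‖) :=
        mul_le_mul_of_nonneg_left (norm_primitiveL_comp_sub_le hL u v) (abs_nonneg _)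
    _ = |ε| * L * ‖u - v‖ := by ring
    _ ≤ 1 / 4 * ‖u - v‖ := mul_le_mul_of_nonneg_right hε (norm_nonneg _)

theorem contractingWith_scaledPicard {f : C(E, E)} {L : NNReal} (hL : LipschitzWith L f) {ε : ℝ}
    (hε : |ε| * L ≤ 1 / 4) (x : E) : ContractingWith (1 / 4) (scaledPicard f ε x) := by
  refine ⟨by rw [← NNReal.coe_lt_coe]; norm_num, LipschitzWith.of_dist_le_mul fun u v => ?_⟩
  have := norm_scaledPicard_sub_le hL hε x x u v
  rw [sub_sub_sub_cancel_right] at this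
  rw [dist_eq_norm, dist_eq_norm]
  simpa using this

/-- A time rescaling of a solution of the Picard equation is a solution with rescaled parameter. -/
theorem scaledPicard_rescale {f : C(E, E)} {r : ℝ} {x : E} {u : C(Icc (-1 : ℝ) 1, E)}
    (hu : scaledPicard f r x u = u) {c : ℝ} (hc : c ∈ Icc (-1 : ℝ) 1) :
    ∃ v : C(Icc (-1 : ℝ) 1, E), scaledPicard f (r * c) x v = v ∧
      v ⟨1, by norm_num⟩ = u ⟨c, hc⟩ := by
  have hmem : ∀ s ∈ Icc (-1 : ℝ) 1, c * s ∈ Icc (-1 : ℝ) 1 := fun s hs => by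
    rw [mem_Icc, ← abs_le] at *
    rw [abs_mul]
    exact mul_le_one₀ hc (abs_nonneg _) hs
  refine ⟨⟨fun s => u ⟨c * s, hmem s s.2⟩, by fun_prop⟩, ?_, by simp⟩
  ext s
  conv_rhs => rw [ContinuousMap.coe_mk, ← hu, scaledPicard_apply]
  rw [scaledPicard_apply, mul_smul]
  congr 2
  have h3 := intervalIntegral.smul_integral_comp_mul_left (a := 0) (b := (s : ℝ))
    (fun τ => f (u (projIcc (-1) 1 (by norm_num) τ))) c
  rw [mul_zero] at h3
  rw [← h3]
  congr 1
  refine intervalIntegral.integral_congr fun τ hτ => ?_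
  have hτ' : τ ∈ Icc (-1 : ℝ) 1 :=
    (convex_Icc (-1 : ℝ) 1).ordConnected.uIcc_subset (by norm_num) s.2 hτ
  simp only [ContinuousMap.coe_mk]
  rw [projIcc_of_mem _ hτ', projIcc_of_mem _ (hmem τ hτ')]

variable [CompleteSpace E]

/-- The fixed points of the Picard operators depend smoothly on the parameter and the
initial condition. -/
theorem contDiffAt_scaledPicard_fixedPoint {f : E → E} (hf : ContDiff ℝ (⊤ : ℕ∞) f) {L : NNReal}
    (hL : LipschitzWith L f) {U : ℝ × E → C(Icc (-1 : ℝ) 1, E)} {q : ℝ × E}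
    (hq : |q.1| * L < 1 / 4)
    (hU : ∀ q : ℝ × E, |q.1| * L ≤ 1 / 4 →
      scaledPicard ⟨f, hf.continuous⟩ q.1 q.2 (U q) = U q) :
    ContDiffAt ℝ (⊤ : ℕ∞) U q := by
  let G : (ℝ × E) × C(Icc (-1 : ℝ) 1, E) → C(Icc (-1 : ℝ) 1, E) := fun w =>
    w.2 - scaledPicard ⟨f, hf.continuous⟩ w.1.1 w.1.2 w.2
  have hG : ContDiff ℝ (⊤ : ℕ∞) G := by
    refine contDiff_snd.sub (ContDiff.add ?_ ?_)
    · exact (constMapL (K := Icc (-1 : ℝ) 1) (E := E)).contDiff.comp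
        (contDiff_snd.comp contDiff_fst)
    · exact (contDiff_fst.comp contDiff_fst).smul
        (primitiveL.contDiff.comp ((contDiff_superposition hf).comp contDiff_snd))
  have hGat : ContDiffAt ℝ (⊤ : ℕ∞) G (q, U q) := hG.contDiffAt
  have hne : ((⊤ : ℕ∞) : WithTop ℕ∞) ≠ 0 := by simp
  have hinv : (fderiv ℝ G (q, U q) ∘L .inr ℝ (ℝ × E) C(Icc (-1 : ℝ) 1, E)).IsInvertible := by
    have h1 : HasFDerivAt (fun u => G (q, u))
        (fderiv ℝ G (q, U q) ∘L .inr ℝ (ℝ × E) C(Icc (-1 : ℝ) 1, E)) (U q) :=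
      (hGat.differentiableAt hne).hasFDerivAt.comp (U q) (hasFDerivAt_prodMk_right q (U q))
    rw [← h1.fderiv]
    refine isInvertible_fderiv_of_lipschitzWith_sub_id (k := 1 / 4)
      (by rw [← NNReal.coe_lt_coe]; norm_num) h1.differentiableAt ?_
    have h2 := (contractingWith_scaledPicard (f := ⟨f, hf.continuous⟩) hL hq.le q.2).2.neg
    have h3 : (fun u => G (q, u) - u) = -scaledPicard ⟨f, hf.continuous⟩ q.1 q.2 := by
      funext u
      simp only [G, Pi.neg_apply]
      abel
    rwa [h3]
  have hev := hGat.eventually_apply_implicitFunction hne hinv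
  refine (hGat.contDiffAt_implicitFunction hne hinv).congr_of_eventuallyEq ?_
  have hlt : ∀ᶠ q' : ℝ × E in nhds q, |q'.1| * L < 1 / 4 :=
    (by fun_prop : Continuous fun q' : ℝ × E =>
      |q'.1| * (L : ℝ)).continuousAt.eventually_lt_const hq
  have hzero : G (q, U q) = 0 := sub_eq_zero.2 (hU q hq.le).symm
  filter_upwards [hev, hlt] with q' h1 h2
  rw [hzero] at h1
  exact (contractingWith_scaledPicard (f := ⟨f, hf.continuous⟩) hL h2.le
    q'.2).fixedPoint_unique' (hU q' h2.le) (sub_eq_zero.1 h1).symm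

/-- A bounded smooth Lipschitz vector field has a smooth local flow with uniform existence time,
close to the identity in the Lipschitz sense. -/
theorem exists_smooth_local_flow {f : E → E} (hf : ContDiff ℝ (⊤ : ℕ∞) f) {L : NNReal}
    (hL : LipschitzWith L f) {M : ℝ} (hM : ∀ x, ‖f x‖ ≤ M) :
    ∃ r > 0, ∃ Ψ : ℝ → E → E,
      ContDiffOn ℝ (⊤ : ℕ∞) (fun q : ℝ × E => Ψ q.1 q.2) (Ioo (-r) r ×ˢ univ) ∧
      (∀ x, Ψ 0 x = x) ∧
      (∀ ε ∈ Ioo (-r) r, ∀ x, HasDerivAt (fun e => Ψ e x) (f (Ψ ε x)) ε) ∧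
      (∀ ε ∈ Ioo (-r) r, LipschitzWith (1 / 2) fun x => Ψ ε x - x) ∧
      ∀ ε ∈ Ioo (-r) r, ∀ x, ‖Ψ ε x - x‖ ≤ |ε| * M := by
  set r : ℝ := 1 / (4 * (L + 1)) with hr
  have hL0 : (0 : ℝ) ≤ L := L.2
  have hr0 : 0 < r := by positivity
  have hrL : r * L < 1 / 4 := by
    rw [hr, div_mul_eq_mul_div, div_lt_div_iff₀ (by positivity) (by norm_num)]
    linarith
  have hsmall : ∀ {ε : ℝ}, |ε| ≤ r → |ε| * L < 1 / 4 := fun h =>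
    (mul_le_mul_of_nonneg_right h hL0).trans_lt hrL
  let fc : C(E, E) := ⟨f, hf.continuous⟩
  have hex : ∀ q : ℝ × E, ∃ u : C(Icc (-1 : ℝ) 1, E),
      |q.1| * L ≤ 1 / 4 → scaledPicard fc q.1 q.2 u = u := fun q => by
    by_cases hq : |q.1| * L ≤ 1 / 4
    · exact ⟨_, fun _ =>
        (contractingWith_scaledPicard (f := fc) hL hq q.2).fixedPoint_isFixedPt⟩
    · exact ⟨0, fun h => absurd h hq⟩
  choose U hU using hex
  have hab : ∀ {ε : ℝ}, ε ∈ Ioo (-r) r → |ε| ≤ r := fun h => (abs_lt.2 h).le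
  let one : Icc (-1 : ℝ) 1 := ⟨1, by norm_num⟩
  have hval : ∀ q : ℝ × E, |q.1| ≤ r → U q one =
      q.2 + q.1 • ∫ τ in (0 : ℝ)..1, f (U q (projIcc (-1) 1 (by norm_num) τ)) := fun q hq => by
    conv_lhs => rw [← hU q (hsmall hq).le]
    rfl
  refine ⟨r, hr0, fun ε x => U (ε, x) one, ?_, ?_, ?_, ?_, ?_⟩
  · intro q hq
    have h1 := contDiffAt_scaledPicard_fixedPoint hf hL (hsmall (hab hq.1)) hU
    exact ((ContinuousMap.evalCLM ℝ one (M := E)).contDiff.contDiffAt.comp q h1).contDiffWithinAt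
  · intro x
    simpa using hval (0, x) (by simpa using hr0.le)
  · intro ε hε x
    have hrr : |r| ≤ r := (abs_of_pos hr0).le
    have hc : ∀ e ∈ Ioo (-r) r, e / r ∈ Icc (-1 : ℝ) 1 := fun e he => by
      rw [mem_Icc, le_div_iff₀ hr0, div_le_one hr0]
      exact ⟨by linarith [he.1], he.2.le⟩
    have hΨ : ∀ e (he : e ∈ Ioo (-r) r), U (e, x) one = U (r, x) ⟨e / r, hc e he⟩ := by
      intro e he
      obtain ⟨v, hv, hv1⟩ := scaledPicard_rescale (hU (r, x) (hsmall hrr).le) (hc e he)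
      rw [show r * (e / r) = e by field_simp] at hv
      rw [← hv1, (contractingWith_scaledPicard (f := fc) hL (hsmall (hab he)).le
        x).fixedPoint_unique' (hU (e, x) (hsmall (hab he)).le) hv]
    have hg : Continuous fun τ : ℝ => f (U (r, x) (projIcc (-1) 1 (by norm_num) τ)) :=
      hf.continuous.comp ((U (r, x)).continuous.comp continuous_projIcc)
    have h1 := (hg.integral_hasStrictDerivAt 0 (ε / r)).hasDerivAt
    have h2 := ((h1.scomp ε ((hasDerivAt_id ε).div_const r)).const_smul r).const_add x
    have h3 : r • (1 / r) • f (U (r, x) (projIcc (-1) 1 (by norm_num) (ε / r))) =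
        f (U (ε, x) one) := by
      rw [smul_smul, mul_one_div_cancel hr0.ne', one_smul, hΨ ε hε, projIcc_of_mem _ (hc ε hε)]
    rw [← h3]
    refine h2.congr_of_eventuallyEq ?_
    filter_upwards [isOpen_Ioo.mem_nhds hε] with e he
    conv_lhs => rw [hΨ e he, ← hU (r, x) (hsmall hrr).le]
    rfl
  · intro ε hε
    refine LipschitzWith.of_dist_le_mul fun x y => ?_
    have hs := (hsmall (hab hε)).le
    have h1 := norm_scaledPicard_sub_le (f := fc) hL hs x y (U (ε, x)) (U (ε, y))
    rw [hU (ε, x) hs, hU (ε, y) hs] at h1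
    have h2 : ‖U (ε, x) - U (ε, y)‖ ≤ 1 / 4 * ‖U (ε, x) - U (ε, y)‖ + ‖x - y‖ := by
      have h3 : U (ε, x) - U (ε, y) = ((U (ε, x) - constMapL x) - (U (ε, y) - constMapL y)) +
          constMapL (x - y) := by
        rw [map_sub]; abel
      have h4 : ‖(constMapL (x - y) : C(Icc (-1 : ℝ) 1, E))‖ ≤ ‖x - y‖ :=
        (ContinuousMap.norm_le _ (norm_nonneg _)).2 fun s => le_rfl
      calc ‖U (ε, x) - U (ε, y)‖ = _ := congrArg norm h3
        _ ≤ _ := norm_add_le _ _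
        _ ≤ _ := add_le_add h1 h4
    have h5 := (ContinuousMap.norm_coe_le_norm
      ((U (ε, x) - constMapL x) - (U (ε, y) - constMapL y)) one).trans h1
    rw [dist_eq_norm, dist_eq_norm]
    refine h5.trans ?_
    simp only [NNReal.coe_div, NNReal.coe_one, NNReal.coe_ofNat]
    linarith [norm_nonneg (x - y)]
  · intro ε hε x
    have h1 := hval (ε, x) (hab hε)
    beta_reduce
    rw [h1, add_sub_cancel_left, norm_smul, Real.norm_eq_abs]
    refine mul_le_mul_of_nonneg_left ?_ (abs_nonneg _)
    have := intervalIntegral.norm_integral_le_of_norm_le_const (a := 0) (b := 1)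
      (f := fun τ => f (U (ε, x) (projIcc (-1) 1 (by norm_num) τ))) (C := M)
      (fun τ _ => hM _)
    simpa using this

end LocalFlow

section NearIdentityFamily

variable {E : Type*} [NormedAddCommGroup E] [NormedSpace ℝ E]

theorem hasDerivAt_prodMk_right_fderiv {G : Type*} [NormedAddCommGroup G] [NormedSpace ℝ G]
    {P : ℝ × E → G} {e : ℝ} {m : E} (h : DifferentiableAt ℝ P (e, m)) :
    HasDerivAt (fun e => P (e, m)) (fderiv ℝ P (e, m) (1, 0)) e :=
  HasFDerivAt.comp_hasDerivAt (l := P) e h.hasFDerivAt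
    ((hasDerivAt_id e).prodMk (hasDerivAt_const e m))

/-- Linearization of a family of maps tangent to a vector field at the identity. -/
theorem hasDerivAt_fderiv_of_hasDerivAt {Ψ : ℝ → E → E} {V : E → E} {m : E}
    (hΨ : ContDiffAt ℝ 2 (fun q : ℝ × E => Ψ q.1 q.2) (0, m))
    (hV : ∀ x, HasDerivAt (fun e => Ψ e x) (V x) 0) :
    HasDerivAt (fun e => fderiv ℝ (Ψ e) m) (fderiv ℝ V m) 0 := by
  set P : ℝ × E → E := fun q => Ψ q.1 q.2
  have hA : DifferentiableAt ℝ (fderiv ℝ P) (0, m) :=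
    (hΨ.fderiv_right (m := 1) (by norm_num)).differentiableAt one_ne_zero
  have hd : ∀ᶠ q in nhds ((0 : ℝ), m), DifferentiableAt ℝ P q :=
    (hΨ.eventually (by simp)).mono fun q hq => hq.differentiableAt two_ne_zero
  have hsymm : IsSymmSndFDerivAt ℝ P (0, m) := hΨ.isSymmSndFDerivAt (by simp)
  have hc1 : ContinuousAt (fun e : ℝ => (e, m)) 0 := by fun_prop
  have hc2 : ContinuousAt (fun x : E => ((0 : ℝ), x)) m := by fun_prop
  have h1 : (fun e => fderiv ℝ (Ψ e) m) =ᶠ[nhds 0]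
      fun e => fderiv ℝ P (e, m) ∘L .inr ℝ ℝ E := by
    filter_upwards [hc1.eventually hd] with e he
    exact (he.hasFDerivAt.comp m (hasFDerivAt_prodMk_right e m)).fderiv
  have h2 : V =ᶠ[nhds m] fun x => fderiv ℝ P (0, x) (1, 0) := by
    filter_upwards [hc2.eventually hd] with x hx
    have h : HasDerivAt (fun e => Ψ e x) (fderiv ℝ P (0, x) (1, 0)) 0 :=
      hasDerivAt_prodMk_right_fderiv hx
    exact (hV x).unique h
  have h3 : HasDerivAt (fun e => fderiv ℝ P (e, m)) (fderiv ℝ (fderiv ℝ P) (0, m) (1, 0)) 0 :=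
    hasDerivAt_prodMk_right_fderiv hA
  have h4 : HasFDerivAt (fun x => fderiv ℝ P (0, x))
      (fderiv ℝ (fderiv ℝ P) (0, m) ∘L .inr ℝ ℝ E) m :=
    hA.hasFDerivAt.comp m (hasFDerivAt_prodMk_right (0 : ℝ) m)
  have h5 := h4.clm_apply (hasFDerivAt_const ((1 : ℝ), (0 : E)) m)
  have h6 := h3.clm_comp (hasDerivAt_const (0 : ℝ) (ContinuousLinearMap.inr ℝ ℝ E))
  rw [h2.fderiv_eq, h5.fderiv]
  refine (h6.congr_of_eventuallyEq h1).congr_deriv ?_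
  ext v
  simp only [ContinuousLinearMap.comp_zero, add_zero, zero_add,
    ContinuousLinearMap.comp_apply, ContinuousLinearMap.inr_apply, ContinuousLinearMap.flip_apply]
  exact hsymm _ _

/-- Derivative at the identity of the pullback of a family of vectors along a family of maps
tangent to `V`. -/
theorem hasDerivAt_pullback_of_hasDerivAt {Ψ : ℝ → E → E} {V : E → E} {m w : E} {F W : ℝ → E}
    (hΨ : ContDiffAt ℝ 2 (fun q : ℝ × E => Ψ q.1 q.2) (0, m))
    (hV : ∀ x, HasDerivAt (fun e => Ψ e x) (V x) 0) (h0 : ∀ x, Ψ 0 x = x)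
    (hF : DifferentiableAt ℝ F 0) (hW : HasDerivAt W w 0)
    (hFW : ∀ᶠ e in nhds 0, fderiv ℝ (Ψ e) m (F e) = W e) :
    HasDerivAt F (w - fderiv ℝ V m (F 0)) 0 := by
  have h1 := (hasDerivAt_fderiv_of_hasDerivAt hΨ hV).clm_apply hF.hasDerivAt
  have h2 : fderiv ℝ (Ψ 0) m = ContinuousLinearMap.id ℝ E := by
    rw [funext h0]; exact fderiv_fun_id
  have h3 := h1.unique (hW.congr_of_eventuallyEq hFW)
  rw [h2, ContinuousLinearMap.id_apply] at h3
  rw [← h3, add_sub_cancel_left]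
  exact hF.hasDerivAt

/-- First order Taylor expansion in time, uniformly over a compact set of parameters. -/
theorem exists_norm_sub_sub_smul_le_sq {G : Type*} [NormedAddCommGroup G] [NormedSpace ℝ G]
    {F : ℝ × E → G} {r δ : ℝ} (hδr : δ < r)
    (hF : ContDiffOn ℝ 2 F (Ioo (-r) r ×ˢ univ)) {K : Set E} (hK : IsCompact K) {F' : E → G}
    (hF' : ∀ m ∈ K, HasDerivAt (fun e => F (e, m)) (F' m) 0) :
    ∃ C > 0, ∀ ε ∈ Icc 0 δ, ∀ m ∈ K, ‖F (ε, m) - F (0, m) - ε • F' m‖ ≤ C * ε ^ 2 := by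
  have hU : IsOpen (Ioo (-r) r ×ˢ (univ : Set E)) := isOpen_Ioo.prod isOpen_univ
  set g : ℝ × E → G := fun q => fderiv ℝ F q (1, 0)
  have hg : ContDiffOn ℝ 1 g (Ioo (-r) r ×ˢ univ) :=
    (hF.fderiv_of_isOpen hU (by norm_num)).clm_apply contDiffOn_const
  set H : ℝ × E → G := fun q => fderiv ℝ g q (1, 0)
  have hH : ContinuousOn H (Ioo (-r) r ×ˢ univ) :=
    (hg.continuousOn_fderiv_of_isOpen hU le_rfl).clm_apply continuousOn_const
  have hsub : ∀ e ∈ Icc 0 δ, ∀ m : E, (e, m) ∈ Ioo (-r) r ×ˢ (univ : Set E) := fun e he m =>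
    ⟨⟨by linarith [he.1, he.2], by linarith [he.2]⟩, trivial⟩
  have hdF : ∀ e ∈ Icc 0 δ, ∀ m, HasDerivAt (fun e => F (e, m)) (g (e, m)) e := fun e he m =>
    hasDerivAt_prodMk_right_fderiv
      ((hF.contDiffAt (hU.mem_nhds (hsub e he m))).differentiableAt two_ne_zero)
  have hdg : ∀ e ∈ Icc 0 δ, ∀ m, HasDerivAt (fun e => g (e, m)) (H (e, m)) e := fun e he m =>
    hasDerivAt_prodMk_right_fderiv
      ((hg.contDiffAt (hU.mem_nhds (hsub e he m))).differentiableAt one_ne_zero)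
  obtain ⟨C₀, hC₀⟩ := (isCompact_Icc.prod hK).exists_bound_of_continuousOn
    (hH.mono fun q (hq : q ∈ Icc 0 δ ×ˢ K) => hsub q.1 hq.1 q.2)
  refine ⟨max C₀ 1, by positivity, fun ε hε m hm => ?_⟩
  have hIcc : ∀ e ∈ Icc 0 ε, e ∈ Icc 0 δ := fun e he => ⟨he.1, he.2.trans hε.2⟩
  have h0 : (0 : ℝ) ∈ Icc 0 δ := ⟨le_rfl, hε.1.trans hε.2⟩
  have hF'0 : F' m = g (0, m) := (hF' m hm).unique (hdF 0 h0 m)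
  have hgle : ∀ e ∈ Icc 0 ε, ‖g (e, m) - F' m‖ ≤ max C₀ 1 * ε := fun e he => by
    have h := (convex_Icc 0 ε).norm_image_sub_le_of_norm_hasDerivWithin_le
      (fun e he => (hdg e (hIcc e he) m).hasDerivWithinAt)
      (fun e he => (hC₀ (e, m) ⟨hIcc e he, hm⟩).trans (le_max_left C₀ 1)) ⟨le_rfl, hε.1⟩ he
    rw [hF'0]
    refine h.trans (mul_le_mul_of_nonneg_left ?_ (by positivity))
    rw [sub_zero, Real.norm_of_nonneg he.1]
    exact he.2
  have h := (convex_Icc 0 ε).norm_image_sub_le_of_norm_hasDerivWithin_le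
    (fun e he => ((hdF e (hIcc e he) m).sub
      ((hasDerivAt_id e).smul_const (F' m))).hasDerivWithinAt)
    (fun e he => by rw [one_smul]; exact hgle e he) ⟨le_rfl, hε.1⟩ ⟨hε.1, le_rfl⟩
  simp only [Pi.sub_apply, id, zero_smul, sub_zero, Real.norm_of_nonneg hε.1] at h
  calc ‖F (ε, m) - F (0, m) - ε • F' m‖ = ‖F (ε, m) - ε • F' m - F (0, m)‖ := by
        rw [sub_right_comm]
    _ ≤ _ := h
    _ = max C₀ 1 * ε ^ 2 := by ring

end NearIdentityFamily

section Sawtooth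

variable {F : Type*} [NormedAddCommGroup F] [NormedSpace ℝ F]

theorem integral_sawtooth_integral [CompleteSpace F] {g : ℝ → F} (hg : Continuous g)
    (hper : Function.Periodic g (2 * π)) :
    ∫ s in (0 : ℝ)..(2 * π), ∫ t in (0 : ℝ)..(2 * π), (t - π) • g (s + t) = 0 := by
  have hc : Continuous (Function.uncurry fun s t : ℝ => (t - π) • g (s + t)) := by
    unfold Function.uncurry; fun_prop
  rw [MeasureTheory.intervalIntegral_intervalIntegral_swap
    ((hc.continuousOn.integrableOn_compact (isCompact_uIcc.prod isCompact_uIcc)).mono_set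
      (Set.prod_mono uIoc_subset_uIcc uIoc_subset_uIcc))]
  have h1 : ∀ t, ∫ s in (0 : ℝ)..(2 * π), (t - π) • g (s + t) =
      (t - π) • ∫ s in (0 : ℝ)..(2 * π), g s := fun t => by
    rw [intervalIntegral.integral_smul, intervalIntegral.integral_comp_add_right, zero_add,
      add_comm (2 * π), hper.intervalIntegral_add_eq t 0, zero_add]
  simp only [h1]
  rw [intervalIntegral.integral_smul_const, intervalIntegral.integral_sub (by simp) (by simp),
    integral_id, intervalIntegral.integral_const, smul_eq_mul]
  ring_nf
  simp

theorem hasDerivAt_sawtooth_integral [CompleteSpace F] {g : ℝ → F} (hg : Continuous g)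
    (hper : Function.Periodic g (2 * π)) :
    HasDerivAt (fun s => ∫ t in (0 : ℝ)..(2 * π), (t - π) • g (s + t))
      ((2 * π) • g 0 - ∫ t in (0 : ℝ)..(2 * π), g t) 0 := by
  set k : ℝ → F := fun t => (t - π) • g t with hk_def
  have hk : Continuous k := by fun_prop
  have heq : ∀ s, ∫ t in (0 : ℝ)..(2 * π), (t - π) • g (s + t) =
      (∫ t in (0 : ℝ)..(s + 2 * π), k t) - (∫ t in (0 : ℝ)..s, k t) -
        s • ∫ t in (0 : ℝ)..(2 * π), g t := by
    intro s
    have h1 := intervalIntegral.integral_comp_add_left (a := 0) (b := 2 * π)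
      (fun t => (t - s - π) • g t) s
    simp only [add_sub_cancel_left, add_zero] at h1
    have h2 : ∀ t, (t - s - π) • g t = k t - s • g t := fun t => by
      simp only [hk_def, sub_smul]; abel
    rw [h1]
    simp only [h2]
    rw [intervalIntegral.integral_sub (hk.intervalIntegrable _ _)
      ((by fun_prop : Continuous fun t => s • g t).intervalIntegrable _ _),
      intervalIntegral.integral_smul, hper.intervalIntegral_add_eq s 0, zero_add,
      intervalIntegral.integral_interval_sub_left (hk.intervalIntegrable _ _)
        (hk.intervalIntegrable _ _)]
  rw [funext heq]
  have h1 := ((hk.integral_hasStrictDerivAt 0 (0 + 2 * π)).hasDerivAt).comp_add_const 0 (2 * π)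
  have h2 := (hk.integral_hasStrictDerivAt 0 0).hasDerivAt
  have h3 := (hasDerivAt_id (0 : ℝ)).smul_const (∫ t in (0 : ℝ)..(2 * π), g t)
  refine ((h1.sub h2).sub h3).congr_deriv ?_
  have h4 : g (0 + 2 * π) = g 0 := hper 0
  simp only [hk_def, h4, one_smul, ← sub_smul]
  congr 2
  ring

end Sawtooth

section PeriodicFlow

variable {E : Type} [NormedAddCommGroup E] [NormedSpace ℝ E]

/-- `φ` is a smooth complete `2π`-periodic flow generated by the vector field `Υ`. -/
structure IsPeriodicFlow (φ : ℝ → E → E) (Υ : E → E) : Prop where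
  contDiff : ContDiff ℝ (⊤ : ℕ∞) fun q : ℝ × E => φ q.1 q.2
  hasDerivAt : ∀ p t, HasDerivAt (fun s => φ s p) (Υ (φ t p)) t
  zero : ∀ p, φ 0 p = p
  add : ∀ s t p, φ (s + t) p = φ s (φ t p)
  periodic : ∀ t p, φ (t + 2 * π) p = φ t p

namespace IsPeriodicFlow

variable {φ : ℝ → E → E} {Υ Y : E → E} {h : E → ℝ}

theorem contDiff_apply (hφ : IsPeriodicFlow φ Υ) (t : ℝ) : ContDiff ℝ (⊤ : ℕ∞) (φ t) :=
  hφ.contDiff.comp (contDiff_const.prodMk contDiff_id)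

theorem differentiableAt (hφ : IsPeriodicFlow φ Υ) (t : ℝ) (p : E) :
    DifferentiableAt ℝ (φ t) p :=
  (hφ.contDiff_apply t).differentiable (by simp) p

theorem hasDerivAt_zero (hφ : IsPeriodicFlow φ Υ) (p : E) :
    HasDerivAt (fun s => φ s p) (Υ p) 0 := by
  simpa only [hφ.zero] using hφ.hasDerivAt p 0

theorem fderiv_comp_fderiv (hφ : IsPeriodicFlow φ Υ) (s t : ℝ) (p : E) :
    fderiv ℝ (φ s) (φ t p) ∘L fderiv ℝ (φ t) p = fderiv ℝ (φ (s + t)) p := by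
  rw [funext (hφ.add s t)]
  exact ((hφ.differentiableAt s _).hasFDerivAt.comp p
    (hφ.differentiableAt t p).hasFDerivAt).fderiv.symm

theorem fderiv_zero (hφ : IsPeriodicFlow φ Υ) (p : E) :
    fderiv ℝ (φ 0) p = ContinuousLinearMap.id ℝ E := by
  rw [funext hφ.zero]; exact fderiv_fun_id

theorem neg_apply (hφ : IsPeriodicFlow φ Υ) (t : ℝ) (p : E) : φ (-t) (φ t p) = p := by
  rw [← hφ.add, neg_add_cancel, hφ.zero]

theorem fderiv_inverse (hφ : IsPeriodicFlow φ Υ) (t : ℝ) (p : E) :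
    (fderiv ℝ (φ t) p).inverse = fderiv ℝ (φ (-t)) (φ t p) := by
  refine ContinuousLinearMap.inverse_eq ?_ ?_
  · have := hφ.fderiv_comp_fderiv t (-t) (φ t p)
    rwa [hφ.neg_apply, add_neg_cancel, hφ.fderiv_zero] at this
  · rw [hφ.fderiv_comp_fderiv, neg_add_cancel, hφ.fderiv_zero]

theorem pullback_eq (hφ : IsPeriodicFlow φ Υ) (Y : E → E) (t : ℝ) (p : E) :
    VectorField.pullback ℝ (φ t) Y p = fderiv ℝ (φ (-t)) (φ t p) (Y (φ t p)) := by
  rw [VectorField.pullback, hφ.fderiv_inverse]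

theorem pullback_zero (hφ : IsPeriodicFlow φ Υ) (Y : E → E) (p : E) :
    VectorField.pullback ℝ (φ 0) Y p = Y p := by
  rw [hφ.pullback_eq, neg_zero, hφ.zero, hφ.fderiv_zero, ContinuousLinearMap.id_apply]

theorem fderiv_pullback (hφ : IsPeriodicFlow φ Υ) (Y : E → E) (t : ℝ) (p : E) :
    fderiv ℝ (φ t) p (VectorField.pullback ℝ (φ t) Y p) = Y (φ t p) := by
  have h := hφ.fderiv_comp_fderiv t (-t) (φ t p)
  rw [hφ.neg_apply, add_neg_cancel, hφ.fderiv_zero] at h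
  rw [hφ.pullback_eq, ← ContinuousLinearMap.comp_apply, h, ContinuousLinearMap.id_apply]

theorem pullback_pullback (hφ : IsPeriodicFlow φ Υ) (Y : E → E) (s t : ℝ) (p : E) :
    VectorField.pullback ℝ (φ s) (VectorField.pullback ℝ (φ t) Y) p =
      VectorField.pullback ℝ (φ (s + t)) Y p := by
  have h := hφ.fderiv_comp_fderiv (-s) (-t) (φ (s + t) p)
  have h' : φ (-t) (φ (s + t) p) = φ s p := by rw [add_comm s, hφ.add t s, hφ.neg_apply]
  rw [h', ← neg_add] at h
  rw [hφ.pullback_eq, hφ.pullback_eq, hφ.pullback_eq, ← hφ.add t s, add_comm t, ← h,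
    ContinuousLinearMap.comp_apply]

theorem periodic_pullback (hφ : IsPeriodicFlow φ Υ) (Y : E → E) (p : E) :
    Function.Periodic (fun t => VectorField.pullback ℝ (φ t) Y p) (2 * π) := fun t => by
  simp only [VectorField.pullback, funext (hφ.periodic t)]

theorem contDiff_pullback (hφ : IsPeriodicFlow φ Υ) (hY : ContDiff ℝ (⊤ : ℕ∞) Y) :
    ContDiff ℝ (⊤ : ℕ∞) fun q : ℝ × E => VectorField.pullback ℝ (φ q.1) Y q.2 := by
  have h1 : ∀ t p (v : E), fderiv ℝ (φ t) p v =
      fderiv ℝ (fun q : ℝ × E => φ q.1 q.2) (t, p) (0, v) := fun t p v => by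
    have h : HasFDerivAt (φ t) _ p := ((hφ.contDiff.differentiable (by simp)
      (t, p)).hasFDerivAt.comp p (hasFDerivAt_prodMk_right t p))
    rw [h.fderiv]
    simp
  simp only [hφ.pullback_eq, h1]
  have h2 : ContDiff ℝ (⊤ : ℕ∞) fun q : ℝ × E => (-q.1, φ q.1 q.2) :=
    contDiff_fst.neg.prodMk hφ.contDiff
  exact ((hφ.contDiff.fderiv_right (m := (⊤ : ℕ∞)) (by simp)).comp h2).clm_apply
    (contDiff_const.prodMk (hY.comp hφ.contDiff))

theorem continuous_pullback (hφ : IsPeriodicFlow φ Υ) (hY : ContDiff ℝ (⊤ : ℕ∞) Y) (p : E) :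
    Continuous fun t => VectorField.pullback ℝ (φ t) Y p :=
  (hφ.contDiff_pullback hY).continuous.comp (by fun_prop : Continuous fun t : ℝ => (t, p))

theorem continuous_left (hφ : IsPeriodicFlow φ Υ) (p : E) : Continuous fun t => φ t p :=
  continuous_iff_continuousAt.2 fun t => (hφ.hasDerivAt p t).continuousAt

/-- The derivative of the pullback along a flow is the Lie derivative. -/
theorem hasDerivAt_pullback (hφ : IsPeriodicFlow φ Υ) (hY : ContDiff ℝ (⊤ : ℕ∞) Y) (p : E) :
    HasDerivAt (fun s => VectorField.pullback ℝ (φ s) Y p)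
      (fderiv ℝ Y p (Υ p) - fderiv ℝ Υ p (Y p)) 0 := by
  have h1 : DifferentiableAt ℝ (fun s => VectorField.pullback ℝ (φ s) Y p) 0 :=
    (hasDerivAt_prodMk_right_fderiv
      ((hφ.contDiff_pullback hY).differentiable (by simp) (0, p))).differentiableAt
  have h2 : HasFDerivAt Y (fderiv ℝ Y p) (φ 0 p) := by
    rw [hφ.zero]; exact (hY.differentiable (by simp) p).hasFDerivAt
  have h := hasDerivAt_pullback_of_hasDerivAt (W := fun s => Y (φ s p))
    (hφ.contDiff.of_le (WithTop.coe_le_coe.2 (le_top : (2 : ℕ∞) ≤ ⊤))).contDiffAt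
    hφ.hasDerivAt_zero hφ.zero h1
    (h2.comp_hasDerivAt 0 (hφ.hasDerivAt_zero p)) (.of_forall fun s => hφ.fderiv_pullback Y s p)
  rwa [hφ.pullback_zero] at h

theorem contDiff_flowIntegratingVF (hφ : IsPeriodicFlow φ Υ) (hY : ContDiff ℝ (⊤ : ℕ∞) Y) :
    ContDiff ℝ (⊤ : ℕ∞) (flowIntegratingVF E φ Y) :=
  (contDiff_parametric_intervalIntegral
    ((contDiff_fst.sub contDiff_const).smul (hφ.contDiff_pullback hY)) (2 * π)).const_smul _

theorem contDiff_flowIntegratingFn (hφ : IsPeriodicFlow φ Υ) (hh : ContDiff ℝ (⊤ : ℕ∞) h) :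
    ContDiff ℝ (⊤ : ℕ∞) (flowIntegratingFn E φ h) :=
  contDiff_const.mul (contDiff_parametric_intervalIntegral
    ((contDiff_fst.sub contDiff_const).mul (hh.comp hφ.contDiff)) (2 * π))

theorem hasDerivAt_pullback_flowIntegratingVF [CompleteSpace E] (hφ : IsPeriodicFlow φ Υ)
    (hY : ContDiff ℝ (⊤ : ℕ∞) Y) (p : E) :
    HasDerivAt (fun s => VectorField.pullback ℝ (φ s) (flowIntegratingVF E φ Y) p)
      (Y p - flowAverageVF E φ Y p) 0 := by
  have h1 : ∀ s, VectorField.pullback ℝ (φ s) (flowIntegratingVF E φ Y) p =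
      (2 * π)⁻¹ • ∫ t in (0 : ℝ)..(2 * π),
        (t - π) • VectorField.pullback ℝ (φ (s + t)) Y p := fun s => by
    simp only [← hφ.pullback_pullback]
    rw [VectorField.pullback, flowIntegratingVF, map_smul,
      ← ContinuousLinearMap.intervalIntegral_comp_comm]
    · simp only [map_smul]
      rfl
    · exact ((continuous_id.sub continuous_const).smul
        (hφ.continuous_pullback hY (φ s p))).intervalIntegrable _ _
  rw [funext h1]
  refine ((hasDerivAt_sawtooth_integral (hφ.continuous_pullback hY p)
    (hφ.periodic_pullback Y p)).const_smul (2 * π)⁻¹).congr_deriv ?_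
  rw [hφ.pullback_zero, smul_sub, inv_smul_smul₀ (by positivity), flowAverageVF]

theorem hasDerivAt_flowIntegratingFn (hφ : IsPeriodicFlow φ Υ) (hh : Continuous h) (p : E) :
    HasDerivAt (fun s => flowIntegratingFn E φ h (φ s p))
      (h p - (2 * π)⁻¹ * ∫ t in (0 : ℝ)..(2 * π), h (φ t p)) 0 := by
  have h1 : ∀ s, flowIntegratingFn E φ h (φ s p) =
      (2 * π)⁻¹ • ∫ t in (0 : ℝ)..(2 * π), (t - π) • h (φ (s + t) p) := fun s => by
    simp only [flowIntegratingFn, smul_eq_mul, add_comm s, hφ.add]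
  rw [funext h1]
  refine ((hasDerivAt_sawtooth_integral (g := fun t => h (φ t p))
    (hh.comp (hφ.continuous_left p))
    fun t => by simp only [hφ.periodic]).const_smul (2 * π)⁻¹).congr_deriv ?_
  rw [hφ.zero, smul_sub, inv_smul_smul₀ (by positivity), smul_eq_mul]

theorem integral_flowIntegratingFn (hφ : IsPeriodicFlow φ Υ) (hh : Continuous h) (p : E) :
    ∫ s in (0 : ℝ)..(2 * π), flowIntegratingFn E φ h (φ s p) = 0 := by
  have := integral_sawtooth_integral (g := fun t => h (φ t p)) (hh.comp (hφ.continuous_left p))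
    fun t => by simp only [hφ.periodic]
  simp only [flowIntegratingFn, intervalIntegral.integral_const_mul, ← hφ.add]
  simp only [smul_eq_mul, add_comm] at this ⊢
  rw [this, mul_zero]

variable {ω : E → ℝ}

theorem fderiv_pullback_of_invariant (hφ : IsPeriodicFlow φ Υ) (hω : Differentiable ℝ ω)
    (hinv : ∀ t p, ω (φ t p) = ω p) (Y : E → E) (t : ℝ) (p : E) :
    fderiv ℝ ω p (VectorField.pullback ℝ (φ t) Y p) = fderiv ℝ ω (φ t p) (Y (φ t p)) := by
  have h := (hω (φ t p)).hasFDerivAt.comp p (hφ.differentiableAt t p).hasFDerivAt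
  have h' : ω ∘ φ t = ω := funext (hinv t)
  rw [h'] at h
  rw [h.fderiv, ContinuousLinearMap.comp_apply, hφ.fderiv_pullback]

theorem fderiv_eq_zero_of_invariant (hφ : IsPeriodicFlow φ Υ) (hω : Differentiable ℝ ω)
    (hinv : ∀ t p, ω (φ t p) = ω p) (p : E) : fderiv ℝ ω p (Υ p) = 0 := by
  have h1 : HasFDerivAt ω (fderiv ℝ ω p) (φ 0 p) := by
    rw [hφ.zero]; exact (hω p).hasFDerivAt
  have h := h1.comp_hasDerivAt 0 (hφ.hasDerivAt_zero p)
  have h' : (ω ∘ fun s => φ s p) = fun _ => ω p := funext fun s => hinv s p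
  rw [h'] at h
  exact h.unique (hasDerivAt_const _ _)

theorem fderiv_flowIntegratingVF_of_invariant [CompleteSpace E] (hφ : IsPeriodicFlow φ Υ)
    (hω : Differentiable ℝ ω) (hinv : ∀ t p, ω (φ t p) = ω p)
    (hY : ContDiff ℝ (⊤ : ℕ∞) Y) (p : E) :
    fderiv ℝ ω p (flowIntegratingVF E φ Y p) =
      flowIntegratingFn E φ (fun q => fderiv ℝ ω q (Y q)) p := by
  rw [flowIntegratingVF, map_smul, ← ContinuousLinearMap.intervalIntegral_comp_comm]
  · simp only [map_smul, hφ.fderiv_pullback_of_invariant hω hinv]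
    rfl
  · exact ((continuous_id.sub continuous_const).smul
      (hφ.continuous_pullback hY p)).intervalIntegrable _ _

theorem pullback_generator (hφ : IsPeriodicFlow φ Υ) (t : ℝ) (p : E) :
    VectorField.pullback ℝ (φ t) Υ p = Υ p := by
  have h1 : HasFDerivAt (φ (-t)) (fderiv ℝ (φ (-t)) (φ t p)) (φ t p) :=
    (hφ.differentiableAt (-t) _).hasFDerivAt
  have h2 := h1.comp_hasDerivAt t (hφ.hasDerivAt p t)
  have h3 : HasDerivAt (fun s => φ (-t + s) p) (Υ p) t := by
    have h4 : HasDerivAt (fun s => φ s p) (Υ p) (-t + t) := by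
      rw [neg_add_cancel]; exact hφ.hasDerivAt_zero p
    exact h4.comp_const_add (-t) t
  simp only [hφ.add] at h3
  rw [hφ.pullback_eq]
  exact h2.unique h3

/-- The field `ω⁻¹ S(X₁) + ω⁻³ S²(L_{X₁} ω) X₀`, with `X₀ = ω Υ`, solves the homological
equation `[Z, X₀] + X₁ = ⟨X₁⟩`. -/
theorem homological_equation [CompleteSpace E] (hφ : IsPeriodicFlow φ Υ)
    (hΥ : ContDiff ℝ (⊤ : ℕ∞) Υ) (hω : ContDiff ℝ (⊤ : ℕ∞) ω) (hpos : ∀ p, 0 < ω p)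
    (hinv : ∀ t p, ω (φ t p) = ω p) {X₀ X₁ Z : E → E} (hX₀ : X₀ = fun p => ω p • Υ p)
    (hX₁ : ContDiff ℝ (⊤ : ℕ∞) X₁)
    (hZ : Z = fun p => (ω p)⁻¹ • flowIntegratingVF E φ X₁ p +
      (((ω p) ^ 3)⁻¹ * flowIntegratingFn E φ
        (flowIntegratingFn E φ fun q => fderiv ℝ ω q (X₁ q)) p) • X₀ p) :
    ContDiff ℝ (⊤ : ℕ∞) Z ∧ ∀ p, X₁ p + fderiv ℝ X₀ p (Z p) - fderiv ℝ Z p (X₀ p) =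
      flowAverageVF E φ X₁ p := by
  have hωd : Differentiable ℝ ω := hω.differentiable (by simp)
  have hX₀s : ContDiff ℝ (⊤ : ℕ∞) X₀ := hX₀ ▸ hω.smul hΥ
  set h : E → ℝ := fun q => fderiv ℝ ω q (X₁ q) with hh_def
  have hh : ContDiff ℝ (⊤ : ℕ∞) h :=
    (hω.fderiv_right (m := (⊤ : ℕ∞)) (by simp)).clm_apply hX₁
  have hSh := hφ.contDiff_flowIntegratingFn hh
  have hZs : ContDiff ℝ (⊤ : ℕ∞) Z := by
    rw [hZ]
    exact ((hω.inv fun p => (hpos p).ne').smul (hφ.contDiff_flowIntegratingVF hX₁)).add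
      ((((hω.pow 3).inv fun p => (pow_pos (hpos p) 3).ne').mul
        (hφ.contDiff_flowIntegratingFn hSh)).smul hX₀s)
  refine ⟨hZs, fun p => ?_⟩
  have hω0 : ω p ≠ 0 := (hpos p).ne'
  have hpb : ∀ s, VectorField.pullback ℝ (φ s) Z p =
      (ω p)⁻¹ • VectorField.pullback ℝ (φ s) (flowIntegratingVF E φ X₁) p +
        (((ω p) ^ 2)⁻¹ * flowIntegratingFn E φ (flowIntegratingFn E φ h) (φ s p)) • Υ p :=
    fun s => by
      have hg := hφ.pullback_generator s p
      rw [VectorField.pullback] at hg ⊢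
      simp only [hZ, hX₀, hinv, map_add, map_smul, hg, VectorField.pullback, smul_smul]
      congr 2
      field_simp
  have hd : HasDerivAt (fun s => VectorField.pullback ℝ (φ s) Z p)
      ((ω p)⁻¹ • (X₁ p - flowAverageVF E φ X₁ p) +
        (((ω p) ^ 2)⁻¹ * flowIntegratingFn E φ h p) • Υ p) 0 := by
    rw [funext hpb]
    have h1 := hφ.hasDerivAt_flowIntegratingFn hSh.continuous p
    rw [hφ.integral_flowIntegratingFn hh.continuous, mul_zero, sub_zero] at h1
    exact ((hφ.hasDerivAt_pullback_flowIntegratingVF hX₁ p).const_smul _).add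
      ((h1.const_mul _).smul_const _)
  have hlie := (hφ.hasDerivAt_pullback hZs p).unique hd
  have hDω : fderiv ℝ ω p (Z p) = (ω p)⁻¹ * flowIntegratingFn E φ h p := by
    simp only [hZ, hX₀, map_add, map_smul, hφ.fderiv_eq_zero_of_invariant hωd hinv, mul_zero,
      add_zero, smul_eq_mul, hφ.fderiv_flowIntegratingVF_of_invariant hωd hinv hX₁, hh_def]
  have hDX₀ : fderiv ℝ X₀ p (Z p) = ω p • fderiv ℝ Υ p (Z p) + fderiv ℝ ω p (Z p) • Υ p := by
    rw [hX₀, fderiv_fun_smul (hωd p) (hΥ.differentiable (by simp) p)]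
    simp
  have hΥZ : fderiv ℝ Z p (X₀ p) = ω p • fderiv ℝ Z p (Υ p) := by rw [hX₀, map_smul]
  rw [hΥZ, sub_eq_iff_eq_add.1 hlie, hDX₀, hDω, smul_add, smul_add, smul_smul, smul_smul,
    mul_inv_cancel₀ hω0, one_smul]
  have : ω p * ((ω p ^ 2)⁻¹ * flowIntegratingFn E φ h p) =
      (ω p)⁻¹ * flowIntegratingFn E φ h p := by
    field_simp
  rw [this]
  abel

end IsPeriodicFlow

end PeriodicFlow

section NormalForm

variable {E : Type*} [NormedAddCommGroup E] [NormedSpace ℝ E]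

/-- A smooth vector field on a finite dimensional space coincides on any given ball with a
compactly supported one. -/
theorem exists_contDiff_hasCompactSupport_eqOn_closedBall [FiniteDimensional ℝ E] {Z : E → E}
    (hZ : ContDiff ℝ (⊤ : ℕ∞) Z) (R : ℝ) :
    ∃ V : E → E, ContDiff ℝ (⊤ : ℕ∞) V ∧ HasCompactSupport V ∧
      EqOn V Z (Metric.closedBall 0 R) := by
  let χ : ContDiffBump (0 : E) := ⟨max R 1, max R 1 + 1, by positivity, by linarith⟩
  refine ⟨fun x => χ x • Z x, χ.contDiff.smul hZ, χ.hasCompactSupport.smul_right,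
    fun x hx => ?_⟩
  simp only [χ.one_of_mem_closedBall (Metric.closedBall_subset_closedBall (le_max_left R 1) hx),
    one_smul]

/-- The local flow of a smooth, bounded and Lipschitz vector field `V` consists of embeddings, and
pulling back `X₀ + ε X₁` along it gives `X₀ + ε (X₁ + [V, X₀]) + O(ε²)`, uniformly on compact
sets. -/
theorem exists_local_flow_pullback_expansion [CompleteSpace E] {V X₀ X₁ : E → E}
    (hV : ContDiff ℝ (⊤ : ℕ∞) V) {L : NNReal} (hL : LipschitzWith L V) {M : ℝ}
    (hM : ∀ x, ‖V x‖ ≤ M) (hX₀ : ContDiff ℝ (⊤ : ℕ∞) X₀) (hX₁ : ContDiff ℝ (⊤ : ℕ∞) X₁) :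
    ∃ r > 0, ∃ Ψ : ℝ → E → E, (∀ x, Ψ 0 x = x) ∧
      (∀ ε ∈ Ioo (-r) r, (∀ x, HasDerivAt (fun e => Ψ e x) (V (Ψ ε x)) ε) ∧
        Function.Injective (Ψ ε) ∧ ContDiff ℝ (⊤ : ℕ∞) (Ψ ε) ∧
        (∀ x, (fderiv ℝ (Ψ ε) x).IsInvertible) ∧ ∀ x, ‖Ψ ε x - x‖ ≤ |ε| * M) ∧
      ∀ δ < r, ∀ K : Set E, IsCompact K → ∃ C > 0, ∀ ε ∈ Icc 0 δ, ∀ m ∈ K,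
        ‖(fderiv ℝ (Ψ ε) m).inverse (X₀ (Ψ ε m) + ε • X₁ (Ψ ε m)) - X₀ m -
          ε • (X₁ m + fderiv ℝ X₀ m (V m) - fderiv ℝ V m (X₀ m))‖ ≤ C * ε ^ 2 := by
  obtain ⟨r, hr, Ψ, hΨ, hΨ0, hΨV, hΨL, hΨM⟩ := exists_smooth_local_flow hV hL hM
  have hU : IsOpen (Ioo (-r) r ×ˢ (univ : Set E)) := isOpen_Ioo.prod isOpen_univ
  have h2le : (2 : WithTop ℕ∞) ≤ (⊤ : ℕ∞) := WithTop.coe_le_coe.2 (le_top : (2 : ℕ∞) ≤ ⊤)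
  have hΨat : ∀ ε ∈ Ioo (-r) r, ∀ x,
      ContDiffAt ℝ (⊤ : ℕ∞) (fun q : ℝ × E => Ψ q.1 q.2) (ε, x) :=
    fun ε hε x => hΨ.contDiffAt (hU.mem_nhds ⟨hε, trivial⟩)
  have hΨε : ∀ ε ∈ Ioo (-r) r, ContDiff ℝ (⊤ : ℕ∞) (Ψ ε) := fun ε hε =>
    contDiff_iff_contDiffAt.2 fun x =>
      (hΨat ε hε x).comp x (contDiffAt_const.prodMk contDiffAt_id)
  have hinv : ∀ ε ∈ Ioo (-r) r, ∀ x, (fderiv ℝ (Ψ ε) x).IsInvertible := fun ε hε x =>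
    isInvertible_fderiv_of_lipschitzWith_sub_id (by norm_num)
      ((hΨε ε hε).differentiable (by simp) x) (hΨL ε hε)
  have hinj : ∀ ε ∈ Ioo (-r) r, Function.Injective (Ψ ε) := fun ε hε x y hxy => by
    have h := (hΨL ε hε).dist_le_mul x y
    rw [dist_eq_norm, dist_eq_norm, hxy, sub_sub_sub_cancel_left, norm_sub_rev y x] at h
    push_cast at h
    exact sub_eq_zero.1 (norm_le_zero_iff.1 (by linarith))
  refine ⟨r, hr, Ψ, hΨ0, fun ε hε => ⟨hΨV ε hε, hinj ε hε, hΨε ε hε, hinv ε hε, hΨM ε hε⟩,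
    fun δ hδ K hK => ?_⟩
  have h0 : (0 : ℝ) ∈ Ioo (-r) r := ⟨by linarith, hr⟩
  have hΨV0 : ∀ x, HasDerivAt (fun e => Ψ e x) (V x) 0 := fun x => by
    simpa only [hΨ0] using hΨV 0 h0 x
  set F : ℝ × E → E := fun q => (fderiv ℝ (Ψ q.1) q.2).inverse
    (X₀ (Ψ q.1 q.2) + q.1 • X₁ (Ψ q.1 q.2)) with hF_def
  have hfd : EqOn (fun q : ℝ × E => fderiv ℝ (Ψ q.1) q.2)
      (fun q => fderiv ℝ (fun q : ℝ × E => Ψ q.1 q.2) q ∘L .inr ℝ ℝ E)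
      (Ioo (-r) r ×ˢ univ) := fun q hq =>
    (((hΨat q.1 hq.1 q.2).differentiableAt (by simp)).hasFDerivAt.comp q.2
      (hasFDerivAt_prodMk_right q.1 q.2)).fderiv
  have hfds : ContDiffOn ℝ (⊤ : ℕ∞) (fun q : ℝ × E => fderiv ℝ (Ψ q.1) q.2)
      (Ioo (-r) r ×ˢ univ) :=
    ((hΨ.fderiv_of_isOpen hU (m := (⊤ : ℕ∞)) (by simp)).clm_comp contDiffOn_const).congr hfd
  have hF : ContDiffOn ℝ 2 F (Ioo (-r) r ×ˢ univ) := by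
    refine ContDiffOn.of_le (n := (⊤ : ℕ∞)) (ContDiffOn.clm_apply (fun q hq => ?_)
      ((hX₀.comp_contDiffOn hΨ).add (contDiffOn_fst.smul (hX₁.comp_contDiffOn hΨ)))) h2le
    exact ((hinv q.1 hq.1 q.2).contDiffAt_map_inverse).comp_contDiffWithinAt q (hfds q hq)
  have hF0 : ∀ m, F (0, m) = X₀ m := fun m => by
    have h : fderiv ℝ (Ψ 0) m = ContinuousLinearMap.id ℝ E := by
      rw [funext hΨ0]; exact fderiv_fun_id
    simp [hF_def, h, hΨ0]
  have hF' : ∀ m ∈ K, HasDerivAt (fun e => F (e, m))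
      (X₁ m + fderiv ℝ X₀ m (V m) - fderiv ℝ V m (X₀ m)) 0 := fun m _ => by
    have h1 : ∀ {Y : E → E}, ContDiff ℝ (⊤ : ℕ∞) Y →
        HasDerivAt (fun e => Y (Ψ e m)) (fderiv ℝ Y m (V m)) 0 := fun {Y} hY => by
      have h : HasFDerivAt Y (fderiv ℝ Y m) (Ψ 0 m) := by
        rw [hΨ0]; exact (hY.differentiable (by simp) m).hasFDerivAt
      exact h.comp_hasDerivAt 0 (hΨV0 m)
    have hW : HasDerivAt (fun e => X₀ (Ψ e m) + e • X₁ (Ψ e m))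
        (X₁ m + fderiv ℝ X₀ m (V m)) 0 :=
      ((h1 hX₀).add ((hasDerivAt_id (0 : ℝ)).smul (h1 hX₁))).congr_deriv (by
        simp [hΨ0, add_comm])
    have h := hasDerivAt_pullback_of_hasDerivAt ((hΨat 0 h0 m).of_le h2le) hΨV0 hΨ0
      (F := fun e => F (e, m)) (hasDerivAt_prodMk_right_fderiv
        ((hF.contDiffAt (hU.mem_nhds ⟨h0, trivial⟩)).differentiableAt
          two_ne_zero)).differentiableAt hW ?_
    · rwa [hF0] at h
    · filter_upwards [isOpen_Ioo.mem_nhds h0] with e he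
      exact (hinv e he m).self_apply_inverse _
  obtain ⟨C, hC, h⟩ := exists_norm_sub_sub_smul_le_sq hδ hF hK hF'
  exact ⟨C, hC, fun ε hε m hm => by simpa only [hF0] using h ε hε m hm⟩

end NormalForm

/-- **`S¹`-invariant normalization of first order on a domain with compact closure.**
Let `Υ` be a smooth vector field on `ℝⁿ` with complete `2π`-periodic flow `φ`, let `ω` be a
smooth positive flow-invariant function, `X₀ = ω·Υ`, and let `X₁` be a smooth vector field.
Let `Z = (1/ω)·S(X₁) + (1/ω³)·S(S(L_{X₁}ω))·X₀`. Then for every open `N ⊆ ℝⁿ` with compact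
closure there are `δ > 0` and `C > 0` and a map `Ψ` which is the flow of `Z` on
`(-δ, δ) × N`, such that each `Ψ_ε` is a smooth injection on `N` with invertible differential
at every `m ∈ N`, and for all `ε ∈ [0, δ]`, `m ∈ N`,
`‖(D_mΨ_ε)⁻¹((X₀ + εX₁)(Ψ_ε(m))) - X₀(m) - ε⟨X₁⟩(m)‖ ≤ C ε²`. -/
theorem invariant_normalization_first_order
    (n : ℕ)
    (Υ : EuclideanSpace ℝ (Fin n) → EuclideanSpace ℝ (Fin n)) (hΥ : ContDiff ℝ (⊤ : ℕ∞) Υ)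
    (φ : ℝ → EuclideanSpace ℝ (Fin n) → EuclideanSpace ℝ (Fin n))
    (hφΥ : ∀ p t, HasDerivAt (fun s => φ s p) (Υ (φ t p)) t)
    (hφ : ContDiff ℝ (⊤ : ℕ∞) (fun q : ℝ × EuclideanSpace ℝ (Fin n) => φ q.1 q.2))
    (hφ0 : ∀ p, φ 0 p = p)
    (hφadd : ∀ s t p, φ (s + t) p = φ s (φ t p))
    (hφper : ∀ t p, φ (t + 2 * π) p = φ t p)
    (ω : EuclideanSpace ℝ (Fin n) → ℝ) (hω : ContDiff ℝ (⊤ : ℕ∞) ω) (hωpos : ∀ p, 0 < ω p)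
    (hωinv : ∀ t p, ω (φ t p) = ω p)
    (X₀ : EuclideanSpace ℝ (Fin n) → EuclideanSpace ℝ (Fin n))
    (hX₀ : X₀ = fun p => ω p • Υ p)
    (X₁ : EuclideanSpace ℝ (Fin n) → EuclideanSpace ℝ (Fin n)) (hX₁ : ContDiff ℝ (⊤ : ℕ∞) X₁)
    (Z : EuclideanSpace ℝ (Fin n) → EuclideanSpace ℝ (Fin n))
    (hZ : Z = fun p =>
      (ω p)⁻¹ • flowIntegratingVF _ φ X₁ p +
        (((ω p) ^ 3)⁻¹ *
          flowIntegratingFn _ φ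
            (flowIntegratingFn _ φ (fun q => fderiv ℝ ω q (X₁ q))) p) • X₀ p)
    (N : Set (EuclideanSpace ℝ (Fin n))) (hN : IsOpen N) (hNc : IsCompact (closure N)) :
    ∃ δ > 0, ∃ C > 0,
      ∃ Ψ : ℝ → EuclideanSpace ℝ (Fin n) → EuclideanSpace ℝ (Fin n),
        (∀ m ∈ N, Ψ 0 m = m) ∧
        (∀ ε ∈ Ioo (-δ) δ, ∀ m ∈ N, HasDerivAt (fun e => Ψ e m) (Z (Ψ ε m)) ε) ∧
        (∀ ε ∈ Ioo (-δ) δ, Set.InjOn (Ψ ε) N ∧ ContDiffOn ℝ (⊤ : ℕ∞) (Ψ ε) N ∧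
          ∀ m ∈ N, ∃ A : EuclideanSpace ℝ (Fin n) ≃L[ℝ] EuclideanSpace ℝ (Fin n),
            HasFDerivAt (Ψ ε)
              (A : EuclideanSpace ℝ (Fin n) →L[ℝ] EuclideanSpace ℝ (Fin n)) m) ∧
        (∀ ε ∈ Icc (0:ℝ) δ, ∀ m ∈ N,
          ‖(fderiv ℝ (Ψ ε) m).inverse (X₀ (Ψ ε m) + ε • X₁ (Ψ ε m)) -
              X₀ m - ε • flowAverageVF _ φ X₁ m‖ ≤ C * ε ^ 2) := by
  have hflow : IsPeriodicFlow φ Υ := ⟨hφ, hφΥ, hφ0, hφadd, hφper⟩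
  obtain ⟨hZs, hhom⟩ := hflow.homological_equation hΥ hω hωpos hωinv hX₀ hX₁ hZ
  obtain ⟨R, hR⟩ := hNc.isBounded.exists_norm_le
  obtain ⟨V, hV, hVc, hVZ⟩ := exists_contDiff_hasCompactSupport_eqOn_closedBall hZs (R + 1)
  obtain ⟨L, hL⟩ := hV.lipschitzWith_of_hasCompactSupport hVc (by simp)
  obtain ⟨M, hM⟩ := hVc.exists_bound_of_continuous hV.continuous
  have hX₀s : ContDiff ℝ (⊤ : ℕ∞) X₀ := hX₀ ▸ hω.smul hΥ
  obtain ⟨r, hr, Ψ, hΨ0, hΨ, hexp⟩ := exists_local_flow_pullback_expansion hV hL hM hX₀s hX₁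
  have hM0 : 0 ≤ M := (norm_nonneg _).trans (hM 0)
  obtain ⟨δ, hδ, hδr⟩ : ∃ δ > 0, δ < min r (M + 1)⁻¹ := exists_between (by positivity)
  have hδM : δ * M ≤ 1 := by
    have h : δ * (M + 1) ≤ (M + 1)⁻¹ * (M + 1) :=
      mul_le_mul_of_nonneg_right (hδr.le.trans (min_le_right _ _)) (by positivity)
    rw [inv_mul_cancel₀ (by positivity)] at h
    linarith
  replace hδr : δ < r := hδr.trans_le (min_le_left _ _)
  have hsub : ∀ ε ∈ Ioo (-δ) δ, ε ∈ Ioo (-r) r := fun ε hε =>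
    ⟨by linarith [hε.1], by linarith [hε.2]⟩
  obtain ⟨C, hC, hbound⟩ := hexp δ hδr _ hNc
  refine ⟨δ, hδ, C, hC, Ψ, fun m _ => hΨ0 m, fun ε hε m hm => ?_, fun ε hε => ?_,
    fun ε hε m hm => ?_⟩
  · obtain ⟨hd, -, -, -, hb⟩ := hΨ ε (hsub ε hε)
    have h : Ψ ε m ∈ Metric.closedBall (0 : EuclideanSpace ℝ (Fin n)) (R + 1) := by
      rw [mem_closedBall_zero_iff]
      have h1 : |ε| * M ≤ δ * M := mul_le_mul_of_nonneg_right (abs_lt.2 hε).le hM0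
      have h2 := norm_le_norm_add_norm_sub' (Ψ ε m) m
      linarith [hb m, hR m (subset_closure hm)]
    rw [← hVZ h]
    exact hd m
  · obtain ⟨-, hinj, hs, hinv, -⟩ := hΨ ε (hsub ε hε)
    refine ⟨hinj.injOn, hs.contDiffOn, fun m _ => ?_⟩
    obtain ⟨A, hA⟩ := hinv m
    exact ⟨A, hA ▸ (hs.differentiable (by simp) m).hasFDerivAt⟩
  · have hm' := subset_closure hm
    have hVm : V =ᶠ[nhds m] Z := hVZ.eventuallyEq_of_mem <| Filter.mem_of_superset
      (Metric.isOpen_ball.mem_nhds (mem_ball_zero_iff.2 ((hR m hm').trans_lt (lt_add_one R))))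
      Metric.ball_subset_closedBall
    have h := hbound ε hε m hm'
    rwa [hVm.fderiv_eq, hVm.eq_of_nhds, hhom] at h
end

section
/- Suppose there are constants C₁ > 0 and C₂ ≥ 0 such that for all (t,s) ∈ [0,T] × [0,1], the operator norm ‖D_xX_s(γ(t,s))‖ ≤ C₁ and ‖(∂X_s/∂s)(γ(t,s))‖ ≤ C₂. Then the length ℓ(t) = ∫₀¹ ‖∂γ/∂s(t,s)‖ ds of the s-curve s ↦ γ(t,s) satisfies the Gronwall-type estimate ℓ(t) ≤ (C₂/C₁ + ℓ(0)) e^{C₁ t} − C₂/C₁ for all t ∈ [0,T]. -/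
open Real Set intervalIntegral

section

variable {E F : Type*} [NormedAddCommGroup E] [NormedSpace ℝ E]
  [NormedAddCommGroup F] [NormedSpace ℝ F]

/-- The partial derivative of a function of two variables in the first variable. -/
theorem hasDerivAt_partial_fst {f : ℝ × F → E} {f' : ℝ × F →L[ℝ] E} {t : ℝ} {y : F}
    (hf : HasFDerivAt f f' (t, y)) : HasDerivAt (fun t' => f (t', y)) (f' (1, 0)) t :=
  hf.comp_hasDerivAt t ((hasDerivAt_id t).prodMk (hasDerivAt_const t y))

/-- The partial derivative of a function of two real variables in the second variable. -/
theorem hasDerivAt_partial_snd {f : ℝ × ℝ → E} {f' : ℝ × ℝ →L[ℝ] E} {t s : ℝ}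
    (hf : HasFDerivAt f f' (t, s)) : HasDerivAt (fun s' => f (t, s')) (f' (0, 1)) s :=
  hf.comp_hasDerivAt s ((hasDerivAt_const s t).prodMk (hasDerivAt_id s))

/-- For a `C²` surface, the derivative of `∂f/∂t` in the `s` direction is also the derivative
of `∂f/∂s` in the `t` direction. -/
theorem hasDerivAt_partial_comm {f : ℝ × ℝ → E} (hf : ContDiff ℝ 2 f) {t s : ℝ} {v : E}
    (h : HasDerivAt (fun s' => fderiv ℝ f (t, s') (1, 0)) v s) :
    HasDerivAt (fun t' => fderiv ℝ f (t', s) (0, 1)) v t := by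
  have hd : HasFDerivAt (fderiv ℝ f) (fderiv ℝ (fderiv ℝ f) (t, s)) (t, s) :=
    ((hf.fderiv_right (m := 1) (by norm_num)).differentiable (by norm_num) _).hasFDerivAt
  have hsymm : IsSymmSndFDerivAt ℝ f (t, s) :=
    hf.contDiffAt.isSymmSndFDerivAt (by simp)
  have hs := (hasDerivAt_partial_snd hd).clm_apply (hasDerivAt_const s ((1 : ℝ), (0 : ℝ)))
  have ht := (hasDerivAt_partial_fst hd).clm_apply (hasDerivAt_const t ((0 : ℝ), (1 : ℝ)))
  have hv := h.unique hs
  simp only [map_zero, add_zero] at hv ht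
  rwa [hsymm.eq, ← hv] at ht

/-- The derivative of `s ↦ X s (c s)` is bounded by the bounds on the partial derivatives
of `X`. -/
theorem exists_hasDerivAt_norm_le_of_partial {X : ℝ → F → E}
    (hX : Differentiable ℝ (fun q : ℝ × F => X q.1 q.2))
    {c : ℝ → F} {c' : F} {s C₁ C₂ : ℝ} (hc : HasDerivAt c c' s)
    (h₁ : ‖fderiv ℝ (X s) (c s)‖ ≤ C₁) (h₂ : ‖deriv (fun s' => X s' (c s)) s‖ ≤ C₂) :
    ∃ v, HasDerivAt (fun s' => X s' (c s')) v s ∧ ‖v‖ ≤ C₁ * ‖c'‖ + C₂ := by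
  set L := fderiv ℝ (fun q : ℝ × F => X q.1 q.2) (s, c s)
  have hL : HasFDerivAt (fun q : ℝ × F => X q.1 q.2) L (s, c s) := (hX _).hasFDerivAt
  refine ⟨L (1, c'), hL.comp_hasDerivAt (f := fun s' => (s', c s')) s
    ((hasDerivAt_id s).prodMk hc), ?_⟩
  have hx : HasFDerivAt (X s) (L.comp (.inr ℝ ℝ F)) (c s) :=
    hL.comp (c s) (hasFDerivAt_prodMk_right s (c s))
  have hs : HasDerivAt (fun s' => X s' (c s)) (L (1, 0)) s := hasDerivAt_partial_fst hL
  rw [hx.fderiv] at h₁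
  rw [hs.deriv] at h₂
  have hsplit : L (1, c') = L.comp (.inr ℝ ℝ F) c' + L (1, 0) := by
    simp [← map_add]
  rw [hsplit]
  exact (norm_add_le _ _).trans (add_le_add (ContinuousLinearMap.le_of_opNorm_le _ h₁ _) h₂)

/-- Pointwise Grönwall estimate for the variation field `∂γ/∂s` of a surface swept by
trajectories of a family of vector fields. -/
theorem norm_variation_le_gronwallBound {X : ℝ → E → E}
    (hX : Differentiable ℝ (fun q : ℝ × E => X q.1 q.2))
    {γ : ℝ × ℝ → E} (hγ : ContDiff ℝ 2 γ) {T s C₁ C₂ : ℝ}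
    (htraj : ∀ t ∈ Icc 0 T, ∀ᶠ s' in nhds s,
      HasDerivAt (fun t' => γ (t', s')) (X s' (γ (t, s'))) t)
    (h₁ : ∀ t ∈ Icc 0 T, ‖fderiv ℝ (X s) (γ (t, s))‖ ≤ C₁)
    (h₂ : ∀ t ∈ Icc 0 T, ‖deriv (fun s' => X s' (γ (t, s))) s‖ ≤ C₂) :
    ∀ t ∈ Icc 0 T, ‖fderiv ℝ γ (t, s) (0, 1)‖ ≤
      gronwallBound ‖fderiv ℝ γ (0, s) (0, 1)‖ C₁ C₂ t := by
  have hdiff (q : ℝ × ℝ) : HasFDerivAt γ (fderiv ℝ γ q) q :=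
    (hγ.differentiable (by norm_num) q).hasFDerivAt
  have key (t : ℝ) (ht : t ∈ Icc 0 T) : ∃ v,
      HasDerivAt (fun t' => fderiv ℝ γ (t', s) (0, 1)) v t ∧
        ‖v‖ ≤ C₁ * ‖fderiv ℝ γ (t, s) (0, 1)‖ + C₂ := by
    obtain ⟨v, hv, hle⟩ := exists_hasDerivAt_norm_le_of_partial hX
      (c := fun s' => γ (t, s')) (hasDerivAt_partial_snd (hdiff (t, s))) (h₁ t ht) (h₂ t ht)
    refine ⟨v, hasDerivAt_partial_comm hγ (hv.congr_of_eventuallyEq ?_), hle⟩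
    filter_upwards [htraj t ht] with s' hs'
    exact (hasDerivAt_partial_fst (hdiff (t, s'))).unique hs'
  choose! v hv hle using key
  intro t ht
  simpa using norm_le_gronwallBound_of_norm_deriv_right_le
    (fun t ht => (hv t ht).continuousAt.continuousWithinAt)
    (fun t ht => (hv t (Ico_subset_Icc_self ht)).hasDerivWithinAt) le_rfl
    (fun t ht => hle t (Ico_subset_Icc_self ht)) t ht

end

/-- **Gronwall-type estimate for the length of the curves on a parameterized surface.**
Let `X_s` be a smooth one-parameter family of vector fields on `E = ℝⁿ`, `β` a smooth curve,
and `γ(t,s) = Fl^t_{X_s}(β(s))` the surface swept by the trajectories of `X_s` starting at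
`β(s)`. If `‖D_x X_s(γ(t,s))‖ ≤ C₁` and `‖∂X_s/∂s(γ(t,s))‖ ≤ C₂` on `[0,T] × [0,1]`, then the
length `ℓ(t) = ∫₀¹ ‖∂γ/∂s(t,s)‖ ds` of the `s`-curves satisfies
`ℓ(t) ≤ (C₂/C₁ + ℓ(0)) e^{C₁ t} - C₂/C₁` for `t ∈ [0,T]`. -/
theorem gronwall_surface_length
    (n : ℕ)
    (X : ℝ → EuclideanSpace ℝ (Fin n) → EuclideanSpace ℝ (Fin n))
    (hX : ContDiff ℝ (⊤ : ℕ∞) (fun q : ℝ × EuclideanSpace ℝ (Fin n) => X q.1 q.2))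
    (β : ℝ → EuclideanSpace ℝ (Fin n)) (hβ : ContDiff ℝ (⊤ : ℕ∞) β)
    (T : ℝ) (hT : 0 < T)
    (γ : ℝ → ℝ → EuclideanSpace ℝ (Fin n))
    (hγ : ContDiff ℝ (⊤ : ℕ∞) (fun q : ℝ × ℝ => γ q.1 q.2))
    (hγ0 : ∀ s ∈ Icc (0:ℝ) 1, γ 0 s = β s)
    (hγtraj : ∀ s ∈ Icc (0:ℝ) 1, ∀ t ∈ Icc (0:ℝ) T,
      HasDerivAt (fun t' => γ t' s) (X s (γ t s)) t)
    (C₁ C₂ : ℝ) (hC₁ : 0 < C₁) (hC₂ : 0 ≤ C₂)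
    (hb₁ : ∀ t ∈ Icc (0:ℝ) T, ∀ s ∈ Icc (0:ℝ) 1, ‖fderiv ℝ (X s) (γ t s)‖ ≤ C₁)
    (hb₂ : ∀ t ∈ Icc (0:ℝ) T, ∀ s ∈ Icc (0:ℝ) 1,
      ‖deriv (fun s' => X s' (γ t s)) s‖ ≤ C₂) :
    ∀ t ∈ Icc (0:ℝ) T,
      (∫ s in (0:ℝ)..1, ‖deriv (fun s' => γ t s') s‖) ≤
        (C₂ / C₁ + ∫ s in (0:ℝ)..1, ‖deriv (fun s' => γ 0 s') s‖) * Real.exp (C₁ * t)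
          - C₂ / C₁ := by
  intro t ht
  have hγ2 : ContDiff ℝ 2 (fun q : ℝ × ℝ => γ q.1 q.2) := contDiff_infty.1 hγ 2
  have hderiv (t s : ℝ) : deriv (fun s' => γ t s') s =
      fderiv ℝ (fun q : ℝ × ℝ => γ q.1 q.2) (t, s) (0, 1) :=
    (hasDerivAt_partial_snd (hγ2.differentiable (by norm_num) (t, s)).hasFDerivAt).deriv
  have hcont (t : ℝ) : Continuous fun s => ‖deriv (fun s' => γ t s') s‖ := by
    simp only [hderiv]
    have := hγ2.continuous_fderiv (by norm_num)
    fun_prop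
  have hpt : ∀ s ∈ Ioo (0 : ℝ) 1, ‖deriv (fun s' => γ t s') s‖ ≤
      (C₂ / C₁ + ‖deriv (fun s' => γ 0 s') s‖) * Real.exp (C₁ * t) - C₂ / C₁ := by
    intro s hs
    have hs' := Ioo_subset_Icc_self hs
    have hG := norm_variation_le_gronwallBound (hX.differentiable (by simp)) hγ2
      (fun t ht => by
        filter_upwards [Icc_mem_nhds hs.1 hs.2] with s' hs'
        exact hγtraj s' hs' t ht)
      (fun t ht => hb₁ t ht s hs') (fun t ht => hb₂ t ht s hs') t ht
    rw [gronwallBound_of_K_ne_0 hC₁.ne'] at hG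
    rw [hderiv, hderiv]
    linarith
  have hsum : IntervalIntegrable (fun s => C₂ / C₁ + ‖deriv (fun s' => γ 0 s') s‖)
      MeasureTheory.volume 0 1 :=
    (continuous_const.add (hcont 0)).intervalIntegrable _ _
  have hbound : IntervalIntegrable
      (fun s => (C₂ / C₁ + ‖deriv (fun s' => γ 0 s') s‖) * Real.exp (C₁ * t))
      MeasureTheory.volume 0 1 := hsum.mul_const _
  calc _ ≤ ∫ s in (0 : ℝ)..1,
        ((C₂ / C₁ + ‖deriv (fun s' => γ 0 s') s‖) * Real.exp (C₁ * t) - C₂ / C₁) :=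
        integral_mono_on_of_le_Ioo zero_le_one ((hcont t).intervalIntegrable _ _)
          (hbound.sub intervalIntegrable_const) hpt
    _ = _ := by
        rw [integral_sub hbound intervalIntegrable_const, integral_mul_const,
          integral_add intervalIntegrable_const ((hcont 0).intervalIntegrable _ _)]
        simp
end
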